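/- Let k ≥ 2 be an integer and let G be a minimally (k,k)-edge-connected graph of size m ≥ (432k)², where m − k ≡ 1 (mod 2). Then ρ(G) ≤ ρ(K^{k−2}_{2,(m−k−1)/2} * K₃), with equality if and only if G is isomorphic to K^{k−2}_{2,(m−k−1)/2} * K₃. -/

import Mathlib

open SimpleGraph

/-- The `l`-edge-connectivity of a graph: the minimum number of edges whose removal
leaves a graph with at least `l` connected components, if the graph has at least `l`
vertices; otherwise the number of vertices. -/
noncomputable def edgeConnL {V : Type*} (l : ℕ) (G : SimpleGraph V) : ℕ :=
  if l ≤ Nat.card V then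
    sInf {c : ℕ | ∃ F : Set (Sym2 V), F ⊆ G.edgeSet ∧ F.ncard = c ∧
      l ≤ Nat.card (G.deleteEdges F).ConnectedComponent}
  else Nat.card V

/-- A graph is minimally `(k,l)`-edge-connected if it is connected, its
`l`-edge-connectivity is at least `k`, and deleting any edge drops the
`l`-edge-connectivity below `k`. -/
def IsMinimallyKLEdgeConnected {V : Type*} (k l : ℕ) (G : SimpleGraph V) : Prop :=
  G.Connected ∧ k ≤ edgeConnL l G ∧
    ∀ e ∈ G.edgeSet, edgeConnL l (G.deleteEdges {e}) < k

/-- The real adjacency matrix of a simple graph. -/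
noncomputable def adjMat {V : Type*} (G : SimpleGraph V) : Matrix V V ℝ :=
  letI := Classical.decRel G.Adj
  G.adjMatrix ℝ

/-- The spectral radius of a graph: the largest (real) eigenvalue of its adjacency matrix. -/
noncomputable def specRad {V : Type*} [Fintype V] [DecidableEq V]
    (G : SimpleGraph V) : ℝ :=
  sSup (spectrum ℝ (adjMat G))

abbrev KbookTriV (p s : ℕ) : Type := (Unit ⊕ Unit) ⊕ ((Fin s ⊕ Fin p) ⊕ Fin 2)

/-- `K^{p}_{2,s} * K₃`: the graph obtained from the disjoint union of the star `K_{1,p}`,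
a triangle `K₃` and the complete bipartite graph `K_{2,s}` by identifying the centre of the
star, one vertex of the triangle and one of the two vertices of degree `s` of `K_{2,s}`
into a single vertex.  Here `Sum.inl (Sum.inl _)` is the identified vertex,
`Sum.inl (Sum.inr _)` is the other vertex of the part of size two, `Fin s` is the part of
size `s`, `Fin p` are the pendant vertices and `Fin 2` are the other two triangle vertices. -/
def KbookTri (p s : ℕ) : SimpleGraph (KbookTriV p s) :=
  SimpleGraph.fromRel (fun a b =>
    match a, b with
    | Sum.inl (Sum.inl _), Sum.inr _ => True
    | Sum.inl (Sum.inr _), Sum.inr (Sum.inl (Sum.inl _)) => True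
    | Sum.inr (Sum.inr _), Sum.inr (Sum.inr _) => True
    | _, _ => False)


section SpectralRadius

theorem adjMat_isHermitian {V : Type*} (G : SimpleGraph V) : (adjMat G).IsHermitian := by
  classical
  simp only [adjMat, Matrix.IsHermitian, Matrix.conjTranspose_eq_transpose_of_trivial]
  exact SimpleGraph.transpose_adjMatrix G

variable {V : Type*} [Fintype V]

open Classical in
theorem adjMat_mulVec_apply (G : SimpleGraph V) (x : V → ℝ) (v : V) :
    (adjMat G).mulVec x v = ∑ z, if G.Adj v z then x z else 0 := by
  simp only [adjMat, Matrix.mulVec, dotProduct, SimpleGraph.adjMatrix_apply]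
  refine Finset.sum_congr rfl fun z _ => ?_
  split_ifs <;> simp

variable [DecidableEq V]

theorem specRad_mem_spectrum (G : SimpleGraph V) [Nonempty V] : specRad G ∈ spectrum ℝ (adjMat G) := by
  have hne : (spectrum ℝ (adjMat G)).Nonempty := by
    rw [(adjMat_isHermitian G).spectrum_real_eq_range_eigenvalues]
    exact Set.range_nonempty _
  exact hne.csSup_mem (adjMat G).finite_real_spectrum

theorem posSemidef_specRad_sub (G : SimpleGraph V) [Nonempty V] :
    (algebraMap ℝ (Matrix V V ℝ) (specRad G) - adjMat G).PosSemidef := by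
  rw [Matrix.posSemidef_iff_isHermitian_and_spectrum_nonneg]
  refine ⟨?_, ?_⟩
  · refine Matrix.IsHermitian.sub ?_ (adjMat_isHermitian G)
    rw [Matrix.algebraMap_eq_diagonal]
    exact Matrix.isHermitian_diagonal _
  · rw [← spectrum.singleton_sub_eq]
    rintro a ⟨_, rfl, b, hb, rfl⟩
    have : b ≤ specRad G := le_csSup (adjMat G).finite_real_spectrum.bddAbove hb
    simpa using this

theorem dotProduct_adjMat_mulVec_le (G : SimpleGraph V) [Nonempty V] (y : V → ℝ) :
    y ⬝ᵥ (adjMat G).mulVec y ≤ specRad G * (y ⬝ᵥ y) := by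
  have h := (posSemidef_specRad_sub G).dotProduct_mulVec_nonneg y
  rw [Matrix.sub_mulVec, Algebra.algebraMap_eq_smul_one, Matrix.smul_mulVec, Matrix.one_mulVec,
    dotProduct_sub, dotProduct_smul] at h
  simpa using h

open Classical in
/-- The spectral radius is an eigenvalue with a nonnegative eigenvector. -/
theorem exists_nonneg_eigenvector (G : SimpleGraph V) [Nonempty V] :
    ∃ x : V → ℝ, x ≠ 0 ∧ (∀ v, 0 ≤ x v) ∧
      ∀ v, ∑ z, (if G.Adj v z then x z else 0) = specRad G * x v := by
  have h1 := specRad_mem_spectrum G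
  rw [← Matrix.spectrum_toLin', ← Module.End.hasEigenvalue_iff_mem_spectrum] at h1
  obtain ⟨y, hy⟩ := h1.exists_hasEigenvector
  have hy1 : (adjMat G).mulVec y = specRad G • y := by
    simpa using hy.apply_eq_smul
  have hy0 := hy.2
  have key : (adjMat G).mulVec (fun v => |y v|) = specRad G • (fun v => |y v|) := by
    have hle := dotProduct_adjMat_mulVec_le G (fun v => |y v|)
    have h2 : y ⬝ᵥ (adjMat G).mulVec y ≤ (fun v => |y v|) ⬝ᵥ (adjMat G).mulVec (fun v => |y v|) := by
      simp only [dotProduct, adjMat_mulVec_apply, Finset.mul_sum]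
      refine Finset.sum_le_sum fun i _ => Finset.sum_le_sum fun j _ => ?_
      split_ifs
      · rw [← abs_mul]; exact le_abs_self _
      · simp
    have h3 : (fun v => |y v|) ⬝ᵥ (fun v => |y v|) = y ⬝ᵥ y := by
      simp [dotProduct]
    rw [hy1, dotProduct_smul, smul_eq_mul, ← h3] at h2
    have h4 := (posSemidef_specRad_sub G).dotProduct_mulVec_zero_iff (fun v => |y v|)
    rw [Matrix.sub_mulVec, Algebra.algebraMap_eq_smul_one, Matrix.smul_mulVec, Matrix.one_mulVec,
      dotProduct_sub, dotProduct_smul] at h4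
    have h5 := h4.1 (by simp only [star_trivial, smul_eq_mul]; linarith)
    exact (sub_eq_zero.1 h5).symm
  refine ⟨fun v => |y v|, ?_, fun v => abs_nonneg _, fun v => ?_⟩
  · intro h
    apply hy0
    ext v
    have := congrFun h v
    simpa using this
  · rw [← adjMat_mulVec_apply, key]; simp

theorem specRad_congr {W : Type*} [Fintype W] [DecidableEq W] {G : SimpleGraph V}
    {H : SimpleGraph W} (e : G ≃g H) : specRad G = specRad H := by
  have : adjMat G = Matrix.reindexAlgEquiv ℝ ℝ e.toEquiv.symm (adjMat H) := by
    ext i j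
    have h : H.Adj (e i) (e j) ↔ G.Adj i j := e.map_adj_iff
    simp only [adjMat, SimpleGraph.adjMatrix_apply, Matrix.coe_reindexAlgEquiv,
      Matrix.reindex_apply, Matrix.submatrix_apply]
    by_cases hij : G.Adj i j
    · exact (if_pos hij).trans (if_pos (h.2 hij)).symm
    · exact (if_neg hij).trans (if_neg (mt h.1 hij)).symm
  rw [specRad, specRad, this, AlgEquiv.spectrum_eq]

end SpectralRadius


section KbookTri

theorem two_le_specRad_kbookTri (p s : ℕ) : 2 ≤ specRad (KbookTri p s) := by
  classical
  let y : KbookTriV p s → ℝ := fun v => match v with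
    | Sum.inl (Sum.inl _) => 1
    | Sum.inr (Sum.inr _) => 1
    | _ => 0
  have h := dotProduct_adjMat_mulVec_le (KbookTri p s) y
  generalize specRad (KbookTri p s) = ρ at h
  simp [dotProduct, adjMat_mulVec_apply, Fintype.sum_sum_type, y, KbookTri,
    SimpleGraph.fromRel_adj, -Finset.sum_boole] at h
  linarith

theorem kbookTri_eigen_equations (p s : ℕ) :
    ∃ u w : ℝ, 0 < u ∧ 0 ≤ w ∧
      specRad (KbookTri p s) ^ 2 * w = s * (u + w) ∧
      specRad (KbookTri p s) ^ 2 * u = s * (u + w) + p * u +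
        2 * specRad (KbookTri p s) / (specRad (KbookTri p s) - 1) * u := by
  classical
  have hρ := two_le_specRad_kbookTri p s
  obtain ⟨x, hx0, hx, he⟩ := exists_nonneg_eigenvector (KbookTri p s)
  set ρ := specRad (KbookTri p s)
  set u := x (Sum.inl (Sum.inl ())) with hu
  set w := x (Sum.inl (Sum.inr ())) with hw
  have e1 := he (Sum.inl (Sum.inl ()))
  have e2 := he (Sum.inl (Sum.inr ()))
  have e3 := fun i => he (Sum.inr (Sum.inl (Sum.inl i)))
  have e4 := fun i => he (Sum.inr (Sum.inl (Sum.inr i)))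
  have e5 := fun i => he (Sum.inr (Sum.inr i))
  simp [Fintype.sum_sum_type, KbookTri, SimpleGraph.fromRel_adj, ← hu, ← hw] at e1 e2 e3 e4 e5
  obtain ⟨e5, e6⟩ := e5
  set t := x (Sum.inr (Sum.inr 0)) with ht
  set t' := x (Sum.inr (Sum.inr 1)) with ht'
  have htt : t = t' := by
    have : (ρ + 1) * (t - t') = 0 := by linarith
    rcases mul_eq_zero.1 this with h | h <;> linarith
  have hs1 : ρ * ∑ i, x (Sum.inr (Sum.inl (Sum.inl i))) = s * (u + w) := by
    simp [Finset.mul_sum, ← e3, mul_add]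
  have hs2 : ρ * ∑ i, x (Sum.inr (Sum.inl (Sum.inr i))) = p * u := by
    simp [Finset.mul_sum, ← e4]
  have htu : (ρ - 1) * t = u := by rw [← htt] at e5; linarith
  have hu0 : 0 ≤ u := hx _
  have hw0 : 0 ≤ w := hx _
  have hρ1 : (ρ - 1) ≠ 0 := by linarith
  have hw2 : ρ ^ 2 * w = s * (u + w) := by rw [← hs1, e2]; ring
  have hu2 : ρ ^ 2 * u = s * (u + w) + p * u + 2 * ρ / (ρ - 1) * u := by
    have h2 : 2 * ρ / (ρ - 1) * u = ρ * (t + t') := by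
      rw [← htu, ← htt]; field_simp; ring
    rw [h2, ← hs1, ← hs2, ← mul_add, ← mul_add, e1]; ring
  refine ⟨u, w, lt_of_le_of_ne hu0 ?_, hw0, hw2, hu2⟩
  intro h0
  apply hx0
  rw [← h0] at hw2 hu2 e3 e4 htu
  have hsw : (s : ℝ) * w = 0 := by linarith
  have hw00 : w = 0 := by
    have : ρ ^ 2 * w = 0 := by linarith
    rcases mul_eq_zero.1 this with h | h
    · nlinarith
    · exact h
  have ht0 : t = 0 := (mul_eq_zero.1 htu).resolve_left hρ1
  have hρ0 : ρ ≠ 0 := by linarith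
  ext v
  rcases v with ((v | v) | ((v | v) | v))
  · exact h0.symm
  · exact hw00
  · have := e3 v
    rw [hw00, add_zero, eq_comm] at this
    exact (mul_eq_zero.1 this).resolve_left hρ0
  · exact (mul_eq_zero.1 (e4 v).symm).resolve_left hρ0
  · fin_cases v
    · exact ht0
    · exact htt.symm.trans ht0

theorem kbookTri_specRad_properties (p s : ℕ) (hs : 1 ≤ s) :
    (s : ℝ) < specRad (KbookTri p s) ^ 2 ∧
    2 * s + ((p : ℝ) + 2) / 2 ≤ specRad (KbookTri p s) ^ 2 ∧
    (specRad (KbookTri p s) ^ 2 - s) * (specRad (KbookTri p s) ^ 2 - s -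
      (p + 2 * specRad (KbookTri p s) / (specRad (KbookTri p s) - 1))) = (s : ℝ) ^ 2 := by
  have hρ := two_le_specRad_kbookTri p s
  obtain ⟨u, w, hu, hw, h1, h2⟩ := kbookTri_eigen_equations p s
  set ρ := specRad (KbookTri p s)
  set P := (p : ℝ) + 2 * ρ / (ρ - 1) with hP
  have hP2 : (p : ℝ) + 2 ≤ P := by
    rw [hP]
    gcongr
    rw [le_div_iff₀ (by linarith)]
    linarith
  have hs0 : (1 : ℝ) ≤ s := by exact_mod_cast hs
  have hp0 : (0 : ℝ) ≤ p := p.cast_nonneg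
  set Y := ρ ^ 2 - s with hY
  have e1 : Y * w = s * u := by rw [hY]; linarith
  have hY0 : 0 < Y := by
    by_contra hneg
    have : 0 < s * u := by positivity
    nlinarith
  have e2 : (Y - P) * u = s * w := by rw [hY, hP]; linarith
  have e3 : Y * (Y - P) = (s : ℝ) ^ 2 := by
    have : (Y * (Y - P) - (s : ℝ) ^ 2) * u = 0 := by
      linear_combination Y * e2 + s * e1
    have := (mul_eq_zero.1 this).resolve_right hu.ne'
    linarith
  refine ⟨by linarith, ?_, e3⟩
  have hYP : 0 < Y - P := by
    by_contra hneg
    have : 0 < (s : ℝ) ^ 2 := by positivity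
    nlinarith
  have : (s : ℝ) ≤ Y - P / 2 := by
    apply abs_le_of_sq_le_sq' _ (by linarith) |>.2
    nlinarith
  linarith

/-- The polynomial inequality satisfied by every number above the spectral radius. -/
theorem sq_le_of_specRad_kbookTri_le (p s : ℕ) (hs : 1 ≤ s) {ρ : ℝ}
    (h : specRad (KbookTri p s) ≤ ρ) :
    (s : ℝ) ^ 2 ≤ (ρ ^ 2 - s) * (ρ ^ 2 - s - (p + 2 * ρ / (ρ - 1))) := by
  have h2 := two_le_specRad_kbookTri p s
  obtain ⟨h3, -, h4⟩ := kbookTri_specRad_properties p s hs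
  set σ := specRad (KbookTri p s)
  rw [← h4]
  have hsq : σ ^ 2 ≤ ρ ^ 2 := by gcongr
  have hdiv : 2 * ρ / (ρ - 1) ≤ 2 * σ / (σ - 1) := by
    rw [div_le_div_iff₀ (by linarith) (by linarith)]
    nlinarith
  have hpos : 0 ≤ σ ^ 2 - s - (p + 2 * σ / (σ - 1)) := by
    by_contra hneg
    have : (0 : ℝ) ≤ (s : ℝ) ^ 2 := by positivity
    nlinarith
  apply mul_le_mul <;> linarith

end KbookTri


section Bridges

variable {V : Type*}

theorem card_connectedComponent_deleteEdges_le [Finite V] {G : SimpleGraph V} (hG : G.Connected)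
    (F : Set (Sym2 V)) :
    Nat.card (G.deleteEdges F).ConnectedComponent ≤ F.ncard + 1 := by
  classical
  let Q : SimpleGraph (G.deleteEdges F).ConnectedComponent :=
    SimpleGraph.fromEdgeSet (Sym2.map (G.deleteEdges F).connectedComponentMk '' F)
  have hwalk : ∀ {a b : V}, G.Walk a b → Q.Reachable
      ((G.deleteEdges F).connectedComponentMk a) ((G.deleteEdges F).connectedComponentMk b) := by
    intro a b p
    induction p with
    | nil => exact .rfl
    | @cons u v w h p ih =>
      refine Reachable.trans ?_ ih
      by_cases hF : s(u, v) ∈ F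
      · by_cases hne : (G.deleteEdges F).connectedComponentMk u =
            (G.deleteEdges F).connectedComponentMk v
        · rw [hne]
        · refine Adj.reachable ?_
          rw [SimpleGraph.fromEdgeSet_adj]
          exact ⟨⟨s(u, v), hF, rfl⟩, hne⟩
      · have : (G.deleteEdges F).Adj u v := by
          rw [SimpleGraph.deleteEdges_adj]; exact ⟨h, hF⟩
        rw [SimpleGraph.ConnectedComponent.sound this.reachable]
  have hQ : Q.Connected := by
    have := hG.nonempty
    have : Nonempty (G.deleteEdges F).ConnectedComponent :=
      ⟨(G.deleteEdges F).connectedComponentMk (Classical.arbitrary V)⟩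
    refine ⟨fun c d => ?_⟩
    induction c using SimpleGraph.ConnectedComponent.ind with | _ a =>
    induction d using SimpleGraph.ConnectedComponent.ind with | _ b =>
    exact hwalk (hG a b).some
  refine hQ.card_vert_le_card_edgeSet_add_one.trans ?_
  rw [Nat.card_coe_set_eq]
  have h1 : Q.edgeSet ⊆ Sym2.map (G.deleteEdges F).connectedComponentMk '' F := by
    intro e he
    exact (SimpleGraph.edgeSet_fromEdgeSet _ ▸ he).1
  have h2 := Set.ncard_le_ncard h1 (Set.toFinite _)
  have h3 := Set.ncard_image_le (f := Sym2.map (G.deleteEdges F).connectedComponentMk)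
    (Set.toFinite F)
  omega

theorem card_connectedComponent_lt_of_isBridge [Finite V] {G : SimpleGraph V} {e : Sym2 V}
    (he : e ∈ G.edgeSet) (hb : G.IsBridge e) :
    Nat.card G.ConnectedComponent < Nat.card (G.deleteEdges {e}).ConnectedComponent := by
  induction e with | _ a b =>
  have hle : G.deleteEdges {s(a, b)} ≤ G := SimpleGraph.deleteEdges_le _
  have hs := SimpleGraph.ConnectedComponent.surjective_map_ofLE hle
  refine lt_of_le_of_ne (Nat.card_le_card_of_surjective _ hs) fun heq => ?_
  have := Fintype.ofFinite (G.deleteEdges {s(a, b)}).ConnectedComponent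
  have := Fintype.ofFinite G.ConnectedComponent
  have hinj := ((Fintype.bijective_iff_surjective_and_card _).2
    ⟨hs, by simpa [Nat.card_eq_fintype_card] using heq.symm⟩).1
  have h1 : G.connectedComponentMk a = G.connectedComponentMk b :=
    SimpleGraph.ConnectedComponent.sound (SimpleGraph.Adj.reachable he)
  have h2 : (G.deleteEdges {s(a, b)}).connectedComponentMk a =
      (G.deleteEdges {s(a, b)}).connectedComponentMk b := hinj h1
  exact (SimpleGraph.isBridge_iff.1 hb) (SimpleGraph.ConnectedComponent.exact h2)

theorem le_card_connectedComponent_deleteEdges [Finite V] {G : SimpleGraph V} (hG : G.Connected)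
    (F : Finset (Sym2 V)) (hF : ∀ e ∈ F, e ∈ G.edgeSet ∧ G.IsBridge e) :
    F.card + 1 ≤ Nat.card (G.deleteEdges (F : Set (Sym2 V))).ConnectedComponent := by
  classical
  induction F using Finset.induction_on with
  | empty =>
    have := hG.nonempty
    have : Nonempty (G.deleteEdges ((∅ : Finset (Sym2 V)) : Set (Sym2 V))).ConnectedComponent :=
      ⟨SimpleGraph.connectedComponentMk _ (Classical.arbitrary V)⟩
    have := Nat.card_pos (α := (G.deleteEdges ((∅ : Finset (Sym2 V)) :
      Set (Sym2 V))).ConnectedComponent)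
    rw [Finset.card_empty]
    omega
  | insert e F heF ih =>
    have ih' := ih fun f hf => hF f (Finset.mem_insert_of_mem hf)
    have h1 := hF e (Finset.mem_insert_self _ _)
    have hlt := card_connectedComponent_lt_of_isBridge
      (G := G.deleteEdges (F : Set (Sym2 V))) (e := e)
      (by rw [SimpleGraph.edgeSet_deleteEdges]; exact ⟨h1.1, by simpa using heF⟩)
      (h1.2.anti (SimpleGraph.deleteEdges_le _))
    rw [SimpleGraph.deleteEdges_deleteEdges] at hlt
    have hset : ((insert e F : Finset (Sym2 V)) : Set (Sym2 V)) = (F : Set (Sym2 V)) ∪ {e} := by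
      ext; simp
    rw [hset, Finset.card_insert_of_notMem heF]
    omega

theorem le_natCard_of_le_edgeConnL {G : SimpleGraph V} {k : ℕ} (h : k ≤ edgeConnL k G) :
    k ≤ Nat.card V := by
  by_contra hlt
  rw [edgeConnL, if_neg hlt] at h
  exact hlt h

theorem ncard_bridges_add_two_le [Finite V] {G : SimpleGraph V} {k : ℕ} (hk : 2 ≤ k)
    (hG : IsMinimallyKLEdgeConnected k k G) :
    {e | e ∈ G.edgeSet ∧ G.IsBridge e}.ncard + 2 ≤ k := by
  obtain ⟨hconn, hle, -⟩ := hG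
  by_contra hlt
  obtain ⟨F, hF, hcard⟩ := Set.exists_subset_card_eq (s := {e | e ∈ G.edgeSet ∧ G.IsBridge e})
    (n := k - 1) (by omega)
  have hfin := Set.toFinite F
  have h1 := le_card_connectedComponent_deleteEdges hconn hfin.toFinset
    (fun e he => hF (by simpa using he))
  rw [Set.Finite.coe_toFinset, ← Set.ncard_eq_toFinset_card F hfin, hcard] at h1
  have h2 : edgeConnL k G ≤ k - 1 := by
    rw [edgeConnL, if_pos (le_natCard_of_le_edgeConnL hle)]
    exact Nat.sInf_le ⟨F, fun e he => (hF he).1, hcard, by omega⟩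
  omega

/-- In a minimally `(k,k)`-edge-connected graph with `b` bridges, for each edge `ab` that is not
a bridge there are at least `k - 1 - b` other non-bridges lying on all walks from `a` to `b`
that avoid `ab`. -/
theorem exists_edges_mem_walks [Finite V] {G : SimpleGraph V} {k : ℕ}
    (hG : IsMinimallyKLEdgeConnected k k G) {a b : V} (hab : G.Adj a b)
    (hnb : ¬ G.IsBridge s(a, b)) :
    ∃ F : Set (Sym2 V), k ≤ F.ncard + {e | e ∈ G.edgeSet ∧ G.IsBridge e}.ncard + 1 ∧
      ∀ f ∈ F, ∀ p : G.Walk a b, s(a, b) ∉ p.edges → f ∈ p.edges := by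
  obtain ⟨hconn, hle, hmin⟩ := hG
  have hV := le_natCard_of_le_edgeConnL hle
  have hlt := hmin s(a, b) hab
  have hG'conn := hconn.connected_delete_edge_of_not_isBridge hnb
  set G' := G.deleteEdges {s(a, b)} with hG'
  rw [edgeConnL, if_pos hV] at hlt
  have hne : {c : ℕ | ∃ F : Set (Sym2 V), F ⊆ G'.edgeSet ∧ F.ncard = c ∧
      k ≤ Nat.card (G'.deleteEdges F).ConnectedComponent}.Nonempty := by
    refine ⟨_, G'.edgeSet, subset_rfl, rfl, ?_⟩
    have hbot : G'.deleteEdges G'.edgeSet = ⊥ := by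
      ext x y; simp
    rw [hbot]
    refine hV.trans (Nat.card_le_card_of_injective
      (fun v => (⊥ : SimpleGraph V).connectedComponentMk v) fun x y hxy => ?_)
    exact SimpleGraph.reachable_bot.1 (SimpleGraph.ConnectedComponent.exact hxy)
  obtain ⟨F, hF, hFc, hFk⟩ := Nat.sInf_mem hne
  rw [← hFc] at hlt
  have hFin := Set.toFinite F
  have hbr : ∀ f ∈ F, G'.IsBridge f := by
    intro f hf
    by_contra hnf
    induction f with | _ c d =>
    have h1 := card_connectedComponent_deleteEdges_le
      (hG'conn.connected_delete_edge_of_not_isBridge hnf) (F \ {s(c, d)})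
    rw [SimpleGraph.deleteEdges_deleteEdges, Set.union_sdiff_cancel (by simpa using hf)] at h1
    have h2 := Set.ncard_sdiff_singleton_add_one hf hFin
    omega
  have hFcard : k ≤ F.ncard + 1 :=
    hFk.trans (card_connectedComponent_deleteEdges_le hG'conn F)
  set B := {e | e ∈ G.edgeSet ∧ G.IsBridge e} with hB
  refine ⟨F \ B, ?_, ?_⟩
  · have := Set.ncard_le_ncard_sdiff_add_ncard F B (Set.toFinite _)
    omega
  · rintro f ⟨hf, hfB⟩ p hp
    by_contra hfp
    have hfb := hbr f hf
    have hfG : f ∈ G.edgeSet := SimpleGraph.edgeSet_mono (SimpleGraph.deleteEdges_le _) (hF hf)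
    have hfnb : ¬ G.IsBridge f := fun h => hfB ⟨hfG, h⟩
    induction f with | _ c d =>
    have h1 := hconn.connected_delete_edge_of_not_isBridge hfnb
    have h2 : ¬ (G.deleteEdges {s(c, d)}).IsBridge s(a, b) := by
      rw [SimpleGraph.isBridge_iff, not_not, SimpleGraph.deleteEdges_deleteEdges]
      exact ⟨p.toDeleteEdges _ (by
        intro e he
        simp only [Set.mem_union, Set.mem_singleton_iff, not_or]
        exact ⟨fun h => hfp (h ▸ he), fun h => hp (h ▸ he)⟩)⟩
    have h3 := h1.connected_delete_edge_of_not_isBridge h2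
    rw [SimpleGraph.deleteEdges_deleteEdges, Set.union_comm,
      ← SimpleGraph.deleteEdges_deleteEdges] at h3
    exact SimpleGraph.isBridge_iff.1 hfb (h3 c d)

end Bridges


section NoParallelWalks

variable {V : Type*}

/-- No edge `ab` admits two edge-disjoint walks from `a` to `b` avoiding `ab`. -/
def NoParallelWalks (G : SimpleGraph V) : Prop :=
  ∀ ⦃a b : V⦄, G.Adj a b → ∀ p q : G.Walk a b, s(a, b) ∉ p.edges → s(a, b) ∉ q.edges →
    ∃ f, f ∈ p.edges ∧ f ∈ q.edges

theorem IsMinimallyKLEdgeConnected.noParallelWalks [Finite V] {G : SimpleGraph V} {k : ℕ}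
    (hk : 2 ≤ k) (hG : IsMinimallyKLEdgeConnected k k G) : NoParallelWalks G := by
  intro a b hab p q hp hq
  have hnb : ¬ G.IsBridge s(a, b) := fun h =>
    hp (SimpleGraph.isBridge_iff_forall_walk_mem_edges.1 h p)
  obtain ⟨F, hF, hFw⟩ := exists_edges_mem_walks hG hab hnb
  have hb := ncard_bridges_add_two_le hk hG
  obtain ⟨f, hf⟩ : F.Nonempty := by
    rw [Set.nonempty_iff_ne_empty]
    rintro rfl
    simp at hF
    omega
  exact ⟨f, hFw f hf p hp, hFw f hf q hq⟩

namespace NoParallelWalks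

variable {G : SimpleGraph V}

theorem eq_of_common_neighbors (hG : NoParallelWalks G) {u v a b : V} (huv : G.Adj u v)
    (hua : G.Adj u a) (hav : G.Adj a v) (hub : G.Adj u b) (hbv : G.Adj b v) : a = b := by
  by_contra hab
  have h1 := huv.ne
  have h2 := hua.ne
  have h3 := hav.ne
  have h4 := hub.ne
  have h5 := hbv.ne
  obtain ⟨f, hf, hf'⟩ := hG huv (.cons hua (.cons hav .nil)) (.cons hub (.cons hbv .nil))
    (by simp; grind) (by simp; grind)
  simp at hf hf'
  grind

theorem not_two_squares (hG : NoParallelWalks G) {u v y₁ y₂ v₁ v₂ : V} (huv : G.Adj u v)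
    (h1 : G.Adj v y₁) (h2 : G.Adj y₁ v₁) (h3 : G.Adj v₁ u)
    (h4 : G.Adj v y₂) (h5 : G.Adj y₂ v₂) (h6 : G.Adj v₂ u)
    (h7 : ¬ G.Adj u y₁) (h8 : ¬ G.Adj u y₂) (hy₁ : y₁ ≠ u) (hy₂ : y₂ ≠ u) (hy : y₁ ≠ y₂)
    (hv₁ : v₁ ≠ v) (hv₂ : v₂ ≠ v) (hv : v₁ ≠ v₂) : False := by
  have n1 := huv.ne
  have n2 := h1.ne
  have n3 := h2.ne
  have n4 := h3.ne
  have n5 := h4.ne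
  have n6 := h5.ne
  have n7 := h6.ne
  have m1 : v₁ ≠ y₂ := fun h => h8 (h ▸ h3.symm)
  have m2 : v₂ ≠ y₁ := fun h => h7 (h ▸ h6.symm)
  obtain ⟨f, hf, hf'⟩ := hG huv.symm (.cons h1 (.cons h2 (.cons h3 .nil)))
    (.cons h4 (.cons h5 (.cons h6 .nil)))
    (by simp; grind) (by simp; grind)
  simp only [Walk.edges_cons, Walk.edges_nil, List.mem_cons, List.not_mem_nil, or_false] at hf hf'
  rcases hf with rfl | rfl | rfl <;> rcases hf' with h | h | h <;>
    rw [Sym2.eq_iff] at h <;> grind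

end NoParallelWalks

end NoParallelWalks


section DominantVertex

variable {V : Type*} [Fintype V] {a : V → V → ℝ} {x : V → ℝ} {ρ : ℝ} {u : V} {N W : Finset V}

theorem sum_neighbors_eq (hN : ∀ v ∈ N, a u v = 1) (hW : ∀ v ∈ W, a u v = 0) (hu : a u u = 0)
    (hsplit : ∀ f : V → ℝ, ∑ z, f z = f u + ∑ z ∈ N, f z + ∑ z ∈ W, f z)
    (heig : ∀ v, ∑ z, a v z * x z = ρ * x v) (hxu : x u = 1) : ∑ z ∈ N, x z = ρ := by
  have h := heig u
  rw [hsplit, hxu, hu, Finset.sum_congr rfl fun z hz => by rw [hN z hz, one_mul],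
    Finset.sum_congr (s₁ := W) rfl fun z hz => by rw [hW z hz, zero_mul]] at h
  simpa using h

theorem sq_eigenvalue_eq (hN : ∀ v ∈ N, a u v = 1) (hW : ∀ v ∈ W, a u v = 0) (hu : a u u = 0)
    (hsymm : ∀ v z, a v z = a z v)
    (hsplit : ∀ f : V → ℝ, ∑ z, f z = f u + ∑ z ∈ N, f z + ∑ z ∈ W, f z)
    (heig : ∀ v, ∑ z, a v z * x z = ρ * x v) (hxu : x u = 1) :
    ρ ^ 2 = N.card + ∑ z ∈ N, (∑ y ∈ N, a z y) * x z + ∑ z ∈ W, (∑ y ∈ N, a z y) * x z := by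
  have h1 := sum_neighbors_eq hN hW hu hsplit heig hxu
  have h2 : ∀ v ∈ N, ρ * x v = 1 + ∑ z ∈ N, a v z * x z + ∑ z ∈ W, a v z * x z := by
    intro v hv
    rw [← heig v, hsplit, hxu, hsymm v u, hN v hv, mul_one]
  calc ρ ^ 2 = ∑ v ∈ N, ρ * x v := by rw [← Finset.mul_sum, h1, sq]
    _ = _ := by
      rw [Finset.sum_congr rfl h2, Finset.sum_add_distrib, Finset.sum_add_distrib,
        Finset.sum_comm, Finset.sum_comm (s := N) (t := W)]
      simp [Finset.sum_mul, hsymm]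

theorem sum_sum_adj_eq (hN : ∀ v ∈ N, a u v = 1) (hW : ∀ v ∈ W, a u v = 0) (hu : a u u = 0)
    (hsymm : ∀ v z, a v z = a z v)
    (hsplit : ∀ f : V → ℝ, ∑ z, f z = f u + ∑ z ∈ N, f z + ∑ z ∈ W, f z) :
    ∑ v, ∑ z, a v z = 2 * N.card + ∑ z ∈ N, ∑ y ∈ N, a z y + 2 * ∑ z ∈ W, ∑ y ∈ N, a z y
      + ∑ z ∈ W, ∑ y ∈ W, a z y := by
  have h1 : ∑ z, a u z = N.card := by
    rw [hsplit, hu, Finset.sum_congr rfl hN, Finset.sum_congr (s₁ := W) rfl hW]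
    simp
  have h2 : ∑ v, a v u = N.card := by rw [← h1]; exact Finset.sum_congr rfl fun v _ => hsymm v u
  have h3 : ∑ z ∈ N, ∑ y ∈ W, a z y = ∑ z ∈ W, ∑ y ∈ N, a z y := by
    rw [Finset.sum_comm]; exact Finset.sum_congr rfl fun _ _ => Finset.sum_congr rfl fun _ _ => hsymm _ _
  have h4 : ∀ v, ∑ z, a v z = a v u + ∑ z ∈ N, a v z + ∑ z ∈ W, a v z := fun v => hsplit _
  rw [Finset.sum_congr rfl fun v _ => h4 v, Finset.sum_add_distrib, Finset.sum_add_distrib, h2,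
    hsplit fun v => ∑ z ∈ N, a v z, hsplit fun v => ∑ z ∈ W, a v z, h3,
    Finset.sum_congr rfl hN, Finset.sum_congr (s₁ := W) rfl hW]
  simp
  ring

theorem sum_le_one_of_mul_eq_zero {ι : Type*} {s : Finset ι} {f : ι → ℝ}
    (h01 : ∀ i ∈ s, f i = 0 ∨ f i = 1) (hmul : ∀ i ∈ s, ∀ j ∈ s, i ≠ j → f i * f j = 0) :
    ∑ i ∈ s, f i ≤ 1 := by
  classical
  by_cases h : ∃ i ∈ s, f i = 1
  · obtain ⟨i, hi, hfi⟩ := h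
    rw [Finset.sum_eq_single_of_mem i hi fun j hj hji => by
      simpa [hfi] using hmul i hi j hj hji.symm, hfi]
  · rw [Finset.sum_eq_zero fun i hi => (h01 i hi).resolve_right fun h1 => h ⟨i, hi, h1⟩]
    exact zero_le_one

theorem mul_sum_nonneighbors_le (hN : ∀ v ∈ N, a u v = 1) (hW : ∀ v ∈ W, a u v = 0)
    (hu : a u u = 0) (hsymm : ∀ v z, a v z = a z v) (h01 : ∀ v z, a v z = 0 ∨ a v z = 1)
    (hsplit : ∀ f : V → ℝ, ∑ z, f z = f u + ∑ z ∈ N, f z + ∑ z ∈ W, f z)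
    (heig : ∀ v, ∑ z, a v z * x z = ρ * x v) (hxu : x u = 1)
    (hx0 : ∀ v, 0 ≤ x v) (hx1 : ∀ v, x v ≤ 1)
    (hdisj : ∀ y ∈ W, ∀ y' ∈ W, y ≠ y' → 1 < ∑ z ∈ N, a y z → 2 < ∑ z ∈ N, a y' z →
      ∀ v ∈ N, a y v * a y' v = 0) {w : V} (hw : w ∈ W) :
    ρ * ∑ y ∈ W, a w y * x y ≤ ρ + 3 * ∑ z ∈ W, ∑ y ∈ W, a z y := by
  have hρ := sum_neighbors_eq hN hW hu hsplit heig hxu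
  have ha0 : ∀ v z, 0 ≤ a v z := fun v z => by rcases h01 v z with h | h <;> simp [h]
  have ha1 : ∀ v z, a v z ≤ 1 := fun v z => by rcases h01 v z with h | h <;> simp [h]
  have hW0 : ∀ v, 0 ≤ ∑ y ∈ W, a v y := fun v => Finset.sum_nonneg fun _ _ => ha0 _ _
  have hN0 : ∀ v, 0 ≤ ∑ z ∈ N, a v z * x z :=
    fun v => Finset.sum_nonneg fun _ _ => mul_nonneg (ha0 _ _) (hx0 _)
  have hwW : ∑ y ∈ W, a w y ≤ ∑ z ∈ W, ∑ y ∈ W, a z y :=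
    Finset.single_le_sum (f := fun z => ∑ y ∈ W, a z y) (fun _ _ => hW0 _) hw
  set B := W.filter fun y => 2 < ∑ z ∈ N, a y z with hB
  have hbig : ∑ y ∈ B, ∑ z ∈ N, a y z * x z ≤ ρ := by
    rw [Finset.sum_comm, ← hρ]
    refine Finset.sum_le_sum fun z hz => ?_
    rw [← Finset.sum_mul]
    refine mul_le_of_le_one_left (hx0 z)
      (sum_le_one_of_mul_eq_zero (fun y _ => h01 y z) fun y hy y' hy' hne => ?_)
    rw [hB, Finset.mem_filter] at hy hy'
    exact hdisj y hy.1 y' hy'.1 hne (by linarith [hy.2]) hy'.2 z hz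
  have hterm : ∀ y ∈ W, ρ * (a w y * x y) ≤
      (if 2 < ∑ z ∈ N, a y z then ∑ z ∈ N, a y z * x z else 0) + 2 * a w y + ∑ z ∈ W, a y z := by
    intro y hy
    have h1 : ρ * x y ≤ ∑ z ∈ N, a y z * x z + ∑ z ∈ W, a y z := by
      rw [← heig y, hsplit, hsymm y u, hW y hy, zero_mul, zero_add]
      gcongr with z hz
      exact mul_le_of_le_one_right (ha0 _ _) (hx1 z)
    rcases h01 w y with h0 | h0
    · rw [h0]
      have := hN0 y
      have := hW0 y
      split_ifs <;> nlinarith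
    · rw [h0]
      split_ifs with hb
      · linarith
      · have h2 : ∑ z ∈ N, a y z * x z ≤ ∑ z ∈ N, a y z :=
          Finset.sum_le_sum fun z _ => mul_le_of_le_one_right (ha0 _ _) (hx1 z)
        linarith
  rw [Finset.mul_sum]
  refine (Finset.sum_le_sum hterm).trans ?_
  rw [Finset.sum_add_distrib, Finset.sum_add_distrib, ← Finset.sum_filter, ← Finset.mul_sum]
  linarith

theorem sq_mul_le_of_few_common_neighbors (hN : ∀ v ∈ N, a u v = 1) (hW : ∀ v ∈ W, a u v = 0)
    (hu : a u u = 0) (hsymm : ∀ v z, a v z = a z v) (h01 : ∀ v z, a v z = 0 ∨ a v z = 1)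
    (hsplit : ∀ f : V → ℝ, ∑ z, f z = f u + ∑ z ∈ N, f z + ∑ z ∈ W, f z)
    (heig : ∀ v, ∑ z, a v z * x z = ρ * x v) (hxu : x u = 1)
    (hx0 : ∀ v, 0 ≤ x v) (hx1 : ∀ v, x v ≤ 1)
    (hdisj : ∀ y ∈ W, ∀ y' ∈ W, y ≠ y' → 1 < ∑ z ∈ N, a y z → 2 < ∑ z ∈ N, a y' z →
      ∀ v ∈ N, a y v * a y' v = 0) {w : V} (hw : w ∈ W) (hc : ∑ z ∈ N, a w z ≤ 2) :
    ρ ^ 2 * x w ≤ 3 * ρ + 3 * ∑ z ∈ W, ∑ y ∈ W, a z y := by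
  have h1 := mul_sum_nonneighbors_le hN hW hu hsymm h01 hsplit heig hxu hx0 hx1 hdisj hw
  have hρ : 0 ≤ ρ := by
    rw [← sum_neighbors_eq hN hW hu hsplit heig hxu]
    exact Finset.sum_nonneg fun _ _ => hx0 _
  have h2 : ∑ z ∈ N, a w z * x z ≤ ∑ z ∈ N, a w z := Finset.sum_le_sum fun z _ =>
    mul_le_of_le_one_right (by rcases h01 w z with h | h <;> simp [h]) (hx1 z)
  have h3 := heig w
  rw [hsplit, hsymm w u, hW w hw, zero_mul, zero_add] at h3
  nlinarith

theorem sq_mul_le_of_many_common_neighbors (hN : ∀ v ∈ N, a u v = 1) (hW : ∀ v ∈ W, a u v = 0)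
    (hu : a u u = 0) (hsymm : ∀ v z, a v z = a z v) (h01 : ∀ v z, a v z = 0 ∨ a v z = 1)
    (hsplit : ∀ f : V → ℝ, ∑ z, f z = f u + ∑ z ∈ N, f z + ∑ z ∈ W, f z)
    (heig : ∀ v, ∑ z, a v z * x z = ρ * x v) (hxu : x u = 1)
    (hx0 : ∀ v, 0 ≤ x v) (hx1 : ∀ v, x v ≤ 1)
    (hdisj : ∀ y ∈ W, ∀ y' ∈ W, y ≠ y' → 1 < ∑ z ∈ N, a y z → 2 < ∑ z ∈ N, a y' z →
      ∀ v ∈ N, a y v * a y' v = 0)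
    (hhalf : ∀ z ∈ W, ∑ y ∈ N, a z y ≤ 1 → x z ≤ 1 / 2)
    {w : V} (hw : w ∈ W) (hc : 2 < ∑ z ∈ N, a w z) :
    ρ ^ 2 * x w ≤ (∑ z ∈ N, a w z) * (1 + x w) + ∑ z ∈ N, ∑ y ∈ N, a z y
      + ∑ z ∈ W, (∑ y ∈ N, a z y) * (1 - x z) + ρ + 3 * ∑ z ∈ W, ∑ y ∈ W, a z y := by
  classical
  have h1 := mul_sum_nonneighbors_le hN hW hu hsymm h01 hsplit heig hxu hx0 hx1 hdisj hw
  have ha0 : ∀ v z, 0 ≤ a v z := fun v z => by rcases h01 v z with h | h <;> simp [h]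
  have h3 := heig w
  rw [hsplit, hsymm w u, hW w hw, zero_mul, zero_add] at h3
  have hpair : ∀ y ∈ N, ∀ z ∈ W,
      a w y * (a y z * x z) ≤ (if z = w then a w y * x w else 0) + a z y * (1 - x z) := by
    intro y hy z hz
    have hz1 : 0 ≤ a z y * (1 - x z) := mul_nonneg (ha0 _ _) (by linarith [hx1 z])
    rw [hsymm y z]
    split_ifs with hzw
    · subst hzw
      have : a z y * (a z y * x z) = a z y * x z := by
        rcases h01 z y with h | h <;> simp [h]
      linarith
    · by_cases hz2 : ∑ y ∈ N, a z y ≤ 1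
      · have := hhalf z hz hz2
        rcases h01 w y with h | h <;> rcases h01 z y with h' | h' <;> rw [h, h'] <;> linarith
      · have := hdisj z hz w hw hzw (not_le.1 hz2) hc y hy
        have h0 : a w y * (a z y * x z) = (a z y * a w y) * x z := by ring
        rw [h0, this]
        linarith
  have hterm : ∀ y ∈ N, ρ * (a w y * x y) ≤ a w y + ∑ z ∈ N, a y z
      + (a w y * x w + ∑ z ∈ W, a z y * (1 - x z)) := by
    intro y hy
    have h4 : ρ * (a w y * x y) = a w y * (1 + ∑ z ∈ N, a y z * x z)
        + ∑ z ∈ W, a w y * (a y z * x z) := by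
      have := heig y
      rw [hsplit, hsymm y u, hN y hy, one_mul, hxu] at this
      rw [← Finset.mul_sum, ← mul_add, this]
      ring
    have h5 : ∑ z ∈ N, a y z * x z ≤ ∑ z ∈ N, a y z :=
      Finset.sum_le_sum fun z _ => mul_le_of_le_one_right (ha0 _ _) (hx1 z)
    have h6 : 0 ≤ ∑ z ∈ N, a y z := Finset.sum_nonneg fun _ _ => ha0 _ _
    have h7 := Finset.sum_le_sum (hpair y hy)
    rw [Finset.sum_add_distrib, Finset.sum_ite_eq' W w, if_pos hw] at h7
    have h8 : a w y * (1 + ∑ z ∈ N, a y z * x z) ≤ a w y + ∑ z ∈ N, a y z := by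
      rcases h01 w y with h | h <;> rw [h] <;> linarith
    linarith
  have h9 := Finset.sum_le_sum hterm
  rw [← Finset.mul_sum, Finset.sum_add_distrib, Finset.sum_add_distrib, Finset.sum_add_distrib,
    ← Finset.sum_mul, Finset.sum_comm (s := N) (t := W)] at h9
  simp only [← Finset.sum_mul] at h9
  have h10 : ρ ^ 2 * x w = ρ * ∑ y ∈ N, a w y * x y + ρ * ∑ y ∈ W, a w y * x y := by
    rw [sq, mul_assoc, ← h3, mul_add]
  linarith

theorem exists_dominant_vertex (hN : ∀ v ∈ N, a u v = 1) (hW : ∀ v ∈ W, a u v = 0)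
    (hu : a u u = 0) (hsymm : ∀ v z, a v z = a z v) (h01 : ∀ v z, a v z = 0 ∨ a v z = 1)
    (hsplit : ∀ f : V → ℝ, ∑ z, f z = f u + ∑ z ∈ N, f z + ∑ z ∈ W, f z)
    (heig : ∀ v, ∑ z, a v z * x z = ρ * x v) (hxu : x u = 1)
    (hx0 : ∀ v, 0 ≤ x v) (hx1 : ∀ v, x v ≤ 1)
    (hdisj : ∀ y ∈ W, ∀ y' ∈ W, y ≠ y' → 1 < ∑ z ∈ N, a y z → 2 < ∑ z ∈ N, a y' z →
      ∀ v ∈ N, a y v * a y' v = 0)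
    (hloc : ∀ v ∈ N, ∑ z ∈ N, a v z ≤ 1) {m k : ℝ} (hm : ∑ v, ∑ z, a v z = 2 * m)
    (hk : 2 ≤ k) (hmk : (432 * k) ^ 2 ≤ m) (hρ : m - k / 2 - 1 ≤ ρ ^ 2)
    (hpend : N.card ≤ ∑ z ∈ N, ∑ y ∈ N, a z y + ∑ z ∈ W, ∑ y ∈ N, a z y + k) :
    ∃ w ∈ W, 99 / 100 * m ≤ 2 * ∑ z ∈ N, a w z := by
  classical
  have ha0 : ∀ v z, 0 ≤ a v z := fun v z => by rcases h01 v z with h | h <;> simp [h]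
  have hm' := sum_sum_adj_eq hN hW hu hsymm hsplit
  rw [hm] at hm'
  have hρ0 := sum_neighbors_eq hN hW hu hsplit heig hxu
  have hsq := sq_eigenvalue_eq hN hW hu hsymm hsplit heig hxu
  have hfew := fun w hw => sq_mul_le_of_few_common_neighbors hN hW hu hsymm h01 hsplit heig hxu
    hx0 hx1 hdisj (w := w) hw
  have hmany := fun hhalf w hw => sq_mul_le_of_many_common_neighbors hN hW hu hsymm h01 hsplit
    heig hxu hx0 hx1 hdisj hhalf (w := w) hw
  have hNx : ∑ z ∈ N, (∑ y ∈ N, a z y) * x z ≤ ρ := by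
    rw [← hρ0]
    exact Finset.sum_le_sum fun z hz => mul_le_of_le_one_left (hx0 z) (hloc z hz)
  have hd0 : ∀ z, 0 ≤ ∑ y ∈ N, a z y := fun z => Finset.sum_nonneg fun _ _ => ha0 _ _
  have hE0 : ∀ z ∈ W, 0 ≤ (∑ y ∈ N, a z y) * (1 - x z) :=
    fun z _ => mul_nonneg (hd0 z) (by linarith [hx1 z])
  have hE : ∑ z ∈ W, (∑ y ∈ N, a z y) * (1 - x z) =
      ∑ z ∈ W, ∑ y ∈ N, a z y - ∑ z ∈ W, (∑ y ∈ N, a z y) * x z := by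
    rw [← Finset.sum_sub_distrib]
    exact Finset.sum_congr rfl fun z _ => by ring
  set M1 := ∑ z ∈ N, ∑ y ∈ N, a z y with hM1
  set M2 := ∑ z ∈ W, ∑ y ∈ W, a z y with hM2
  set C := ∑ z ∈ W, ∑ y ∈ N, a z y with hC
  set T := ∑ z ∈ W, (∑ y ∈ N, a z y) * x z with hT
  set E := ∑ z ∈ W, (∑ y ∈ N, a z y) * (1 - x z) with hEdef
  have hM1' : 0 ≤ M1 := Finset.sum_nonneg fun z _ => hd0 z
  have hM2' : 0 ≤ M2 := Finset.sum_nonneg fun z _ => Finset.sum_nonneg fun _ _ => ha0 _ _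
  have hC' : 0 ≤ C := Finset.sum_nonneg fun z _ => hd0 z
  have hE' : 0 ≤ E := Finset.sum_nonneg hE0
  have hρ1 : 0 ≤ ρ := by rw [← hρ0]; exact Finset.sum_nonneg fun _ _ => hx0 _
  clear_value M1 M2 C T E
  have hkm : 373248 * k ≤ m := by nlinarith only [hk, hmk]
  have hρm : ρ ≤ 118 / 100000 * m := by
    by_contra! h
    have h1 : ρ ^ 2 - ρ ≤ m := by linarith
    have h2 : 118 / 100000 * m * (ρ - 1) ≤ ρ * (ρ - 1) :=
      mul_le_mul_of_nonneg_right h.le (by linarith)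
    have h3 : 879 * m ≤ (ρ - 1) * m := mul_le_mul_of_nonneg_right (by linarith) (by linarith)
    linarith
  have hD : M1 + M2 + 2 * E ≤ 24 / 10000 * m := by linarith
  have hρ2 : 998 / 1000 * m ≤ ρ ^ 2 := by linarith
  have hsmall : ∀ w ∈ W, ∑ z ∈ N, a w z ≤ 2 → x w ≤ 1 / 2 := by
    intro w hw hc
    have := hfew w hw hc
    by_contra! h
    have := mul_le_mul hρ2 h.le (by norm_num) (sq_nonneg ρ)
    linarith
  have hbig : ∀ w ∈ W, 1 / 2 < x w → 3 / 10 * m < ∑ z ∈ N, a w z := by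
    intro w hw hxw
    have h2 : 2 < ∑ z ∈ N, a w z := by
      by_contra! h
      linarith [hsmall w hw h]
    have := hmany (fun z hz hz1 => hsmall z hz (by linarith)) w hw h2
    by_contra! h
    have h3 := mul_le_mul_of_nonneg_right hρ2 (hx0 w)
    have h4 := mul_le_mul_of_nonneg_right h (by linarith [hx0 w] : 0 ≤ 1 + x w)
    have h5 : 0 < m * (x w - 1 / 2) := mul_pos (by linarith) (by linarith)
    linarith
  have hd : C + N.card ≤ m := by linarith
  have huniq : ∀ w ∈ W, ∀ w' ∈ W, 1 / 2 < x w → 1 / 2 < x w' → w = w' := by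
    intro w hw w' hw' hxw hxw'
    by_contra hne
    have h1 := hbig w hw hxw
    have h2 := hbig w' hw' hxw'
    have h3 : ∑ z ∈ N, a w z + ∑ z ∈ N, a w' z ≤ N.card := by
      rw [← Finset.sum_add_distrib, Finset.cast_card]
      refine Finset.sum_le_sum fun z hz => ?_
      have := hdisj w hw w' hw' hne (by linarith) (by linarith) z hz
      rcases h01 w z with h | h <;> rcases h01 w' z with h' | h' <;>
        simp_all only [mul_one, one_ne_zero] <;> norm_num
    have h4 : ∑ z ∈ N, a w z + ∑ z ∈ N, a w' z ≤ C := by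
      rw [hC, ← Finset.sum_pair (f := fun w => ∑ z ∈ N, a w z) hne]
      exact Finset.sum_le_sum_of_subset_of_nonneg (by grind) fun z _ _ => hd0 z
    linarith
  have hle : ∀ z, x z ≤ 1 / 2 → ∑ y ∈ N, a z y ≤ 2 * ((∑ y ∈ N, a z y) * (1 - x z)) := by
    intro z hz
    nlinarith only [hd0 z, hz]
  obtain ⟨w, hw, hxw⟩ : ∃ w ∈ W, 1 / 2 < x w := by
    by_contra! h
    have : C ≤ 2 * E := by
      rw [hC, hEdef, Finset.mul_sum]
      exact Finset.sum_le_sum fun z hz => hle z (h z hz)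
    linarith
  refine ⟨w, hw, ?_⟩
  have h1 : ∑ z ∈ W.erase w, ∑ y ∈ N, a z y ≤ 2 * E := by
    rw [hEdef, Finset.mul_sum, ← Finset.add_sum_erase W _ hw]
    refine le_add_of_nonneg_of_le (by linarith [hE0 w hw]) (Finset.sum_le_sum fun z hz => hle z ?_)
    rw [Finset.mem_erase] at hz
    by_contra! h
    exact hz.1 (huniq z hz.2 w hw h hxw)
  have h2 : ∑ z ∈ N, a w z + ∑ z ∈ W.erase w, ∑ y ∈ N, a z y = C :=
    hC ▸ Finset.add_sum_erase W (fun z => ∑ y ∈ N, a z y) hw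
  linarith

end DominantVertex

section DominantPair

variable {V : Type*} [Fintype V]

open Classical in
theorem exists_normalized_eigenvector [DecidableEq V] [Nonempty V] (G : SimpleGraph V) :
    ∃ (x : V → ℝ) (u : V), x u = 1 ∧ (∀ v, 0 ≤ x v) ∧ (∀ v, x v ≤ 1) ∧
      ∀ v, ∑ z, (if G.Adj v z then x z else 0) = specRad G * x v := by
  obtain ⟨x, hx, hx0, heig⟩ := exists_nonneg_eigenvector G
  obtain ⟨u, -, hu⟩ := Finset.exists_max_image Finset.univ x Finset.univ_nonempty
  have hu0 : 0 < x u := by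
    refine lt_of_le_of_ne (hx0 u) fun h => hx (funext fun v => ?_)
    exact le_antisymm ((hu v (Finset.mem_univ v)).trans h.ge) (hx0 v)
  refine ⟨fun v => x v / x u, u, div_self hu0.ne', fun v => div_nonneg (hx0 v) hu0.le,
    fun v => (div_le_one hu0).2 (hu v (Finset.mem_univ v)), fun v => ?_⟩
  rw [← mul_div_assoc, ← heig v, Finset.sum_div]
  exact Finset.sum_congr rfl fun z _ => by split_ifs <;> simp

open Classical in
theorem sum_sum_adj_eq_two_mul_ncard (G : SimpleGraph V) :
    ∑ v, ∑ z, (if G.Adj v z then (1 : ℝ) else 0) = 2 * G.edgeSet.ncard := by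
  have h : G.edgeSet.ncard = G.edgeFinset.card := by
    rw [← SimpleGraph.coe_edgeFinset, Set.ncard_coe_finset]
  rw [h, ← Nat.cast_ofNat, ← Nat.cast_mul, ← G.sum_degrees_eq_twice_card_edges, Nat.cast_sum]
  refine Finset.sum_congr rfl fun v _ => ?_
  rw [Finset.sum_boole, ← SimpleGraph.card_neighborFinset_eq_degree,
    SimpleGraph.neighborFinset_eq_filter]

theorem isBridge_of_forall_adj {V : Type*} {G : SimpleGraph V} {u v : V} (huv : u ≠ v)
    (h : ∀ z, G.Adj v z → z = u) : G.IsBridge s(u, v) := by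
  rw [SimpleGraph.isBridge_iff]
  rintro ⟨p⟩
  cases p.reverse with
  | nil => exact huv rfl
  | cons hadj _ =>
    rw [SimpleGraph.deleteEdges_adj] at hadj
    have := h _ hadj.1
    subst this
    exact hadj.2 (by simp [Sym2.eq_swap])

open Classical in
theorem card_neighbors_le (G : SimpleGraph V) (u : V) {b : ℕ}
    (hb : {e | e ∈ G.edgeSet ∧ G.IsBridge e}.ncard ≤ b) :
    ((Finset.univ.filter fun v => G.Adj u v).card : ℝ) ≤
      ∑ v with G.Adj u v, ∑ z with z ≠ u, (if G.Adj v z then (1 : ℝ) else 0) + b := by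
  set N := Finset.univ.filter fun v => G.Adj u v
  have h1 : (N.filter fun v => ∀ z, G.Adj v z → z = u).card ≤ b := by
    rw [← Set.ncard_coe_finset]
    refine le_trans (Set.ncard_le_ncard_of_injOn (fun v => s(u, v)) (fun v hv => ?_)
      (fun v _ v' _ h => ?_) (Set.toFinite _)) hb
    · simp only [N, Finset.coe_filter, Set.mem_ofPred_eq, Finset.mem_filter,
        Finset.mem_univ, true_and] at hv
      exact ⟨hv.1, isBridge_of_forall_adj hv.1.ne hv.2⟩
    · exact Sym2.congr_right.1 h
  have h2 : ((N.filter fun v => ¬ ∀ z, G.Adj v z → z = u).card : ℝ) ≤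
      ∑ v ∈ N, ∑ z with z ≠ u, (if G.Adj v z then (1 : ℝ) else 0) := by
    rw [Finset.cast_card, Finset.sum_filter]
    refine Finset.sum_le_sum fun v _ => ?_
    split_ifs with h
    · exact Finset.sum_nonneg fun _ _ => by split_ifs <;> norm_num
    · push Not at h
      obtain ⟨z, hz, hzu⟩ := h
      refine le_trans (by rw [if_pos hz]) (Finset.single_le_sum
        (f := fun z => if G.Adj v z then (1 : ℝ) else 0)
        (fun _ _ => by split_ifs <;> norm_num) (Finset.mem_filter.2 ⟨Finset.mem_univ z, hzu⟩))
  have h3 := Finset.card_filter_add_card_filter_not (s := N) fun v => ∀ z, G.Adj v z → z = u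
  have h4 : (N.card : ℝ) = (N.filter fun v => ∀ z, G.Adj v z → z = u).card +
    (N.filter fun v => ¬ ∀ z, G.Adj v z → z = u).card := by exact_mod_cast h3.symm
  have h5 : ((N.filter fun v => ∀ z, G.Adj v z → z = u).card : ℝ) ≤ b := by exact_mod_cast h1
  linarith

open Classical in
theorem NoParallelWalks.exists_dominant_pair {G : SimpleGraph V} (hG : NoParallelWalks G)
    {k m : ℕ} (hk : 2 ≤ k) (hm : G.edgeSet.ncard = m) (hmk : (432 * k) ^ 2 ≤ m)
    (hb : {e | e ∈ G.edgeSet ∧ G.IsBridge e}.ncard ≤ k) {x : V → ℝ} {u : V} {ρ : ℝ}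
    (hxu : x u = 1) (hx0 : ∀ v, 0 ≤ x v) (hx1 : ∀ v, x v ≤ 1)
    (heig : ∀ v, ∑ z, (if G.Adj v z then x z else 0) = ρ * x v)
    (hρ : (m : ℝ) - k / 2 - 1 ≤ ρ ^ 2) :
    ∃ w, w ≠ u ∧ ¬ G.Adj u w ∧
      99 / 100 * (m : ℝ) ≤ 2 * (Finset.univ.filter fun z => G.Adj u z ∧ G.Adj w z).card := by
  set N := Finset.univ.filter fun v => G.Adj u v with hN
  set W := Finset.univ.filter fun v => ¬ G.Adj u v ∧ v ≠ u with hW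
  have hNmem : ∀ v, v ∈ N ↔ G.Adj u v := by simp [hN]
  have hWmem : ∀ v, v ∈ W ↔ ¬ G.Adj u v ∧ v ≠ u := by simp [hW]
  have hsplit : ∀ f : V → ℝ, ∑ z, f z = f u + ∑ z ∈ N, f z + ∑ z ∈ W, f z := by
    intro f
    rw [hN, hW, Finset.sum_filter, Finset.sum_filter, ← Finset.sum_ite_eq' Finset.univ u f |>.trans
      (if_pos (Finset.mem_univ u)), ← Finset.sum_add_distrib, ← Finset.sum_add_distrib]
    refine Finset.sum_congr rfl fun z _ => ?_
    by_cases hz : z = u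
    · subst hz; simp
    · by_cases h : G.Adj u z <;> simp [h, hz]
  have hexists : ∀ y (F : Finset V), (F.card : ℝ) < ∑ z ∈ N, (if G.Adj y z then (1 : ℝ) else 0) →
      ∃ z, G.Adj u z ∧ G.Adj y z ∧ z ∉ F := by
    intro y F h
    rw [Finset.sum_boole, Nat.cast_lt] at h
    obtain ⟨z, hz, hzF⟩ := Finset.exists_mem_notMem_of_card_lt_card h
    rw [Finset.mem_filter, hNmem] at hz
    exact ⟨z, hz.1, hz.2, hzF⟩
  obtain ⟨w, hw, hwm⟩ := exists_dominant_vertex (a := fun v z => if G.Adj v z then (1 : ℝ) else 0)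
    (x := x) (ρ := ρ) (u := u) (N := N) (W := W) (m := m) (k := k)
    (fun v hv => if_pos ((hNmem v).1 hv)) (fun v hv => if_neg ((hWmem v).1 hv).1) (by simp)
    (fun v z => by simp [G.adj_comm]) (fun v z => by by_cases h : G.Adj v z <;> simp [h])
    hsplit (fun v => by simpa using heig v) hxu hx0 hx1
    (by
      intro y hy y' hy' hne h1 h2 v hv
      by_contra h
      simp only [mul_ite, mul_one, mul_zero, ite_eq_right_iff, one_ne_zero, imp_false,
        not_forall, not_not] at h
      obtain ⟨hy'v, hyv⟩ := h
      rw [hWmem] at hy hy'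
      obtain ⟨v₁, hv₁⟩ := hexists y {v} (by simpa using h1)
      obtain ⟨v₂, hv₂⟩ := hexists y' {v, v₁} (lt_of_le_of_lt (by
        exact_mod_cast Finset.card_le_two) h2)
      simp only [Finset.mem_singleton, Finset.mem_insert, not_or] at hv₁ hv₂
      exact hG.not_two_squares ((hNmem v).1 hv) hyv.symm hv₁.2.1 hv₁.1.symm hy'v.symm hv₂.2.1
        hv₂.1.symm hy.1 hy'.1 hy.2 hy'.2 hne hv₁.2.2 hv₂.2.2.1 (Ne.symm hv₂.2.2.2))
    (by
      intro v hv
      rw [hNmem] at hv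
      rw [Finset.sum_boole, ← Nat.cast_one, Nat.cast_le, Finset.card_le_one]
      intro y hy z hz
      rw [Finset.mem_filter, hNmem] at hy hz
      exact hG.eq_of_common_neighbors hv hy.1 hy.2.symm hz.1 hz.2.symm)
    (by rw [sum_sum_adj_eq_two_mul_ncard, hm]) (by exact_mod_cast hk) (by exact_mod_cast hmk) hρ
    (by
      have h := card_neighbors_le G u hb
      have h1 : (Finset.univ.filter fun v => v ≠ u) = N ∪ W := by
        ext v
        simp only [hN, hW, Finset.mem_filter, Finset.mem_union, Finset.mem_univ, true_and]
        grind [G.ne_of_adj]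
      have h2 : Disjoint N W := by
        rw [Finset.disjoint_left]
        intro v hv hv'
        exact ((hWmem v).1 hv').1 ((hNmem v).1 hv)
      simp only [h1, Finset.sum_union h2] at h
      rw [Finset.sum_add_distrib, Finset.sum_comm (t := W)] at h
      simpa [hN, G.adj_comm] using h)
  rw [hWmem] at hw
  refine ⟨w, hw.2, hw.1, ?_⟩
  rwa [Finset.sum_boole, hN, Finset.filter_filter] at hwm

end DominantPair

section TwoCentres

variable {V : Type*} [Fintype V] {a : V → V → ℝ} {x : V → ℝ} {ρ : ℝ} {u w : V} {R : Finset V}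

theorem excess_arith {m k s c e t q : ℝ} (hk : 2 ≤ k) (hmk : (432 * k) ^ 2 ≤ m)
    (hm : m = 2 * s + c + e) (hs : 99 / 100 * m ≤ 2 * s) (hc : 0 ≤ c) (he : 0 ≤ e)
    (ht0 : 0 ≤ t) (ht1 : t ≤ 1) (hq : m - k / 2 - 1 ≤ q)
    (h1 : (q - 2 * s) * (1 + t) ≤ c + 4 / 15 * e) (h2 : s ≤ t * (q - s)) :
    15 * c + 26 * e ≤ 15 * k + 30 + 1 / 2 := by
  have hkm : 373248 * k ≤ m := by nlinarith only [hk, hmk]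
  have h3 : q - 2 * s ≤ c + 4 / 15 * e := by
    rcases le_total (q - 2 * s) 0 with h | h
    · linarith
    · linarith [mul_nonneg h ht0]
  have h4 : s ≤ t * (s + (c + 4 / 15 * e)) :=
    h2.trans (mul_le_mul_of_nonneg_left (by linarith) ht0)
  have h5 : 98 / 100 ≤ t := by
    by_contra! h
    have := mul_le_mul_of_nonneg_right h.le (by linarith : 0 ≤ s + (c + 4 / 15 * e))
    linarith
  have h6 : (c + e - k / 2 - 1) * (1 + t) ≤ c + 4 / 15 * e :=
    (mul_le_mul_of_nonneg_right (by linarith) (by linarith)).trans h1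
  have h7 : c + e ≤ 21 / 10 * k := by
    by_contra! h
    have := mul_le_mul_of_nonneg_left h5 (by linarith : 0 ≤ c + e - k / 2 - 1)
    linarith
  have h8 : (1 - t) * s ≤ 21 / 10 * k := by
    have : t * (c + 4 / 15 * e) ≤ c + 4 / 15 * e := mul_le_of_le_one_left (by linarith) ht1
    linarith
  have h9 : (1 - t) * (92000 * k ^ 2) ≤ (1 - t) * s :=
    mul_le_mul_of_nonneg_left (by linarith) (by linarith)
  have h10 : (1 - t) * (21 / 10 * k) ≤ 1 / 10000 := by
    have h11 : k * ((1 - t) * (92000 * k)) ≤ k * (21 / 10) := by linarith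
    have h12 := le_of_mul_le_mul_left h11 (by linarith)
    linarith
  have h13 : (1 - t) * (c + e - k / 2 - 1) ≤ (1 - t) * (21 / 10 * k) :=
    mul_le_mul_of_nonneg_left (by linarith) (by linarith)
  linarith

theorem excess_le_of_dominant_pair (hu : a u u = 0) (hw : a w w = 0) (huw : a u w = 0)
    (hsymm : ∀ v z, a v z = a z v) (h01 : ∀ v z, a v z = 0 ∨ a v z = 1)
    (hsplit : ∀ f : V → ℝ, ∑ z, f z = f u + f w + ∑ z ∈ R, f z)
    (heig : ∀ v, ∑ z, a v z * x z = ρ * x v) (hxu : x u = 1)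
    (hx0 : ∀ v, 0 ≤ x v) (hx1 : ∀ v, x v ≤ 1)
    {m k s c e : ℝ} (hk : 2 ≤ k) (hmk : (432 * k) ^ 2 ≤ m) (hρ : m - k / 2 - 1 ≤ ρ ^ 2)
    (hs : ∑ z ∈ R, a u z * a w z = s) (hc : ∑ z ∈ R, a u z + ∑ z ∈ R, a w z = 2 * s + c)
    (he : ∑ z ∈ R, ∑ y ∈ R, a z y = 2 * e) (hm : m = 2 * s + c + e) (hsm : 99 / 100 * m ≤ 2 * s) :
    15 * c + 26 * e ≤ 15 * k + 30 + 1 / 2 := by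
  have ha0 : ∀ v z, 0 ≤ a v z := fun v z => by rcases h01 v z with h | h <;> simp [h]
  have ha1 : ∀ v z, a v z ≤ 1 := fun v z => by rcases h01 v z with h | h <;> simp [h]
  have haa : ∀ v z, a v z * a v z = a v z := fun v z => by rcases h01 v z with h | h <;> simp [h]
  have hwu : a w u = 0 := by rw [hsymm, huw]
  have hkm : 373248 * k ≤ m := by nlinarith only [hk, hmk]
  have he0 : 0 ≤ 2 * e := by
    rw [← he]
    exact Finset.sum_nonneg fun _ _ => Finset.sum_nonneg fun _ _ => ha0 _ _
  have hsu : s ≤ ∑ z ∈ R, a u z := by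
    rw [← hs]
    exact Finset.sum_le_sum fun z _ => mul_le_of_le_one_right (ha0 _ _) (ha1 _ _)
  have hsw : s ≤ ∑ z ∈ R, a w z := by
    rw [← hs]
    exact Finset.sum_le_sum fun z _ => mul_le_of_le_one_left (ha0 _ _) (ha1 _ _)
  have hrow : ∀ z, ρ * x z = a u z + a w z * x w + ∑ y ∈ R, a z y * x y := by
    intro z
    rw [← heig z, hsplit, hsymm z u, hsymm z w, hxu, mul_one]
  have hcentre : ∀ c, a c u = 0 → a c w = 0 → ρ ^ 2 * x c = ∑ z ∈ R, a c z * a u z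
      + (∑ z ∈ R, a c z * a w z) * x w + ∑ z ∈ R, ∑ y ∈ R, a c z * (a z y * x y) := by
    intro c hcu hcw
    have h := heig c
    rw [hsplit, hcu, hcw, zero_mul, zero_mul, add_zero, zero_add] at h
    calc ρ ^ 2 * x c = ∑ z ∈ R, a c z * (ρ * x z) := by
          rw [sq, mul_assoc, ← h, Finset.mul_sum]
          exact Finset.sum_congr rfl fun z _ => by ring
      _ = _ := by
          simp_rw [hrow, ← Finset.mul_sum, Finset.sum_mul, ← Finset.sum_add_distrib]
          exact Finset.sum_congr rfl fun z _ => by ring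
  have hrest : ∀ c (μ : ℝ), (∀ y ∈ R, x y ≤ μ) → 0 ≤ μ →
      ∑ z ∈ R, ∑ y ∈ R, a c z * (a z y * x y) ≤ μ * (2 * e) := by
    intro c μ hμ hμ0
    rw [← he, Finset.mul_sum]
    refine Finset.sum_le_sum fun z _ => ?_
    rw [Finset.mul_sum]
    refine Finset.sum_le_sum fun y hy => ?_
    have h1 : a z y * x y ≤ a z y * μ := mul_le_mul_of_nonneg_left (hμ y hy) (ha0 _ _)
    have h2 := mul_le_of_le_one_left (mul_nonneg (ha0 z y) (hx0 y)) (ha1 c z)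
    linarith
  have hu2 := hcentre u hu huw
  have hw2 := hcentre w hwu hw
  simp_rw [haa, hsymm w, fun z => mul_comm (a z w) (a u z), ← hsymm w] at hu2 hw2
  rw [hs] at hu2 hw2
  rw [hxu, mul_one] at hu2
  have hρ0 : 0 ≤ ρ := by
    have := hrow u
    rw [hxu, mul_one, hu, hwu] at this
    rw [this, zero_mul, add_zero, zero_add]
    exact Finset.sum_nonneg fun _ _ => mul_nonneg (ha0 _ _) (hx0 _)
  have hsx : s * x w ≤ s := mul_le_of_le_one_right (by linarith) (hx1 w)
  have hρm : ρ ≤ 17 / 10000 * m := by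
    have h1 := hrest u 1 (fun y _ => hx1 y) zero_le_one
    have h2 : ρ ^ 2 ≤ 2 * m := by linarith
    by_contra! h
    have h3 : (17 / 10000 * m) ^ 2 ≤ ρ ^ 2 := pow_le_pow_left₀ (by linarith) h.le 2
    have h4 : 746496 * m ≤ m * m := mul_le_mul_of_nonneg_right (by linarith) (by linarith)
    linarith
  have hμ : ∀ z ∈ R, x z ≤ 1 / 15 := by
    intro z hz
    have h1 : ρ * (ρ * x z) ≤ 2 * ρ + 3 * (2 * e) := by
      have h2 : ∀ v, ρ * x v ≤ 2 + ∑ y ∈ R, a v y * x y := by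
        intro v
        have := mul_le_of_le_one_right (ha0 w v) (hx1 w)
        linarith [hrow v, ha1 u v, ha1 w v]
      have h3 : ρ * ∑ y ∈ R, a z y * x y ≤ 3 * (2 * e) := by
        have h4 : ∑ y ∈ R, ∑ y' ∈ R, a z y * (a y y' * x y') ≤ 2 * e := by
          simpa using hrest z 1 (fun y _ => hx1 y) zero_le_one
        have h5 : ∑ y ∈ R, a z y ≤ 2 * e := by
          rw [← he]
          exact Finset.single_le_sum (f := fun z => ∑ y ∈ R, a z y)
            (fun _ _ => Finset.sum_nonneg fun _ _ => ha0 _ _) hz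
        calc ρ * ∑ y ∈ R, a z y * x y = ∑ y ∈ R, a z y * (ρ * x y) := by
              rw [Finset.mul_sum]
              exact Finset.sum_congr rfl fun y _ => by ring
          _ ≤ ∑ y ∈ R, a z y * (2 + ∑ y' ∈ R, a y y' * x y') :=
              Finset.sum_le_sum fun y _ => mul_le_mul_of_nonneg_left (h2 y) (ha0 _ _)
          _ = (∑ y ∈ R, a z y) * 2 + ∑ y ∈ R, ∑ y' ∈ R, a z y * (a y y' * x y') := by
              simp_rw [mul_add, Finset.sum_add_distrib, Finset.sum_mul, Finset.mul_sum]
          _ ≤ 3 * (2 * e) := by linarith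
      have := mul_le_mul_of_nonneg_left (h2 z) hρ0
      linarith
    by_contra! h
    have h2 : 998 / 1000 * m * (1 / 15) ≤ ρ ^ 2 * x z :=
      mul_le_mul (by linarith) h.le (by norm_num) (sq_nonneg ρ)
    linarith
  have hru := hrest u _ hμ (by norm_num)
  have hrw := hrest w _ hμ (by norm_num)
  have hrw0 : 0 ≤ ∑ z ∈ R, ∑ y ∈ R, a w z * (a z y * x y) :=
    Finset.sum_nonneg fun _ _ => Finset.sum_nonneg fun _ _ =>
      mul_nonneg (ha0 _ _) (mul_nonneg (ha0 _ _) (hx0 _))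
  have hcw : (∑ z ∈ R, a w z - s) * x w ≤ ∑ z ∈ R, a w z - s :=
    mul_le_of_le_one_right (by linarith) (hx1 w)
  have hcw0 : 0 ≤ (∑ z ∈ R, a w z - s) * x w := mul_nonneg (by linarith) (hx0 w)
  exact excess_arith hk hmk hm hsm (by linarith) (by linarith) (hx0 w) (hx1 w) hρ
    (by linarith) (by linarith)

end TwoCentres
section SecondNonbridge

variable {V : Type*}

theorem exists_second_nonbridge {G : SimpleGraph V} {v x : V} (h : G.Adj v x)
    (hb : ¬ G.IsBridge s(v, x)) : ∃ y, y ≠ v ∧ G.Adj x y ∧ ¬ G.IsBridge s(x, y) := by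
  rw [SimpleGraph.isBridge_iff_forall_cycle_notMem (by simpa using h)] at hb
  push Not at hb
  obtain ⟨c, p, hp, hmem⟩ := hb
  have hx : x ∈ p.support := p.snd_mem_support_of_mem_edges hmem
  have h2 := hp.ncard_neighborSet_toSubgraph_eq_two hx
  obtain ⟨y, hy, hyv⟩ := Set.exists_ne_of_one_lt_ncard (h2 ▸ one_lt_two) v
  rw [Subgraph.mem_neighborSet, Walk.adj_toSubgraph_iff_mem_edges] at hy
  exact ⟨y, hyv, p.adj_of_mem_edges hy, fun hbr => hbr.notMem_edges_of_isCycle hp hy⟩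

theorem not_isBridge_of_square {G : SimpleGraph V} {u w z z' : V} (huw : u ≠ w) (hz : z ≠ z')
    (h1 : G.Adj u z) (h2 : G.Adj w z) (h3 : G.Adj u z') (h4 : G.Adj w z') :
    ¬ G.IsBridge s(u, z) := by
  rw [SimpleGraph.isBridge_iff_forall_walk_mem_edges]
  push Not
  refine ⟨.cons h3 (.cons h4.symm (.cons h2 .nil)), ?_⟩
  have := h1.ne
  have := h3.ne
  simp
  grind

theorem IsMinimallyKLEdgeConnected.le_ncard_bridges_add_two [Finite V] {G : SimpleGraph V} {k : ℕ}
    (hG : IsMinimallyKLEdgeConnected k k G) {u w z₁ z₂ z₃ : V} (huw : u ≠ w)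
    (h12 : z₁ ≠ z₂) (h13 : z₁ ≠ z₃) (h23 : z₂ ≠ z₃)
    (hu₁ : G.Adj u z₁) (hw₁ : G.Adj w z₁) (hu₂ : G.Adj u z₂) (hw₂ : G.Adj w z₂)
    (hu₃ : G.Adj u z₃) (hw₃ : G.Adj w z₃) :
    k ≤ {e | e ∈ G.edgeSet ∧ G.IsBridge e}.ncard + 2 := by
  obtain ⟨F, hF, hFw⟩ :=
    exists_edges_mem_walks hG hu₁ (not_isBridge_of_square huw h12 hu₁ hw₁ hu₂ hw₂)
  have n1 := hu₁.ne
  have n2 := hu₂.ne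
  have n3 := hu₃.ne
  have n4 := hw₁.ne
  have n5 := hw₂.ne
  have n6 := hw₃.ne
  have h1 : F ⊆ {s(w, z₁)} := by
    intro f hf
    have hp := hFw f hf (.cons hu₂ (.cons hw₂.symm (.cons hw₁ .nil))) (by simp; grind)
    have hq := hFw f hf (.cons hu₃ (.cons hw₃.symm (.cons hw₁ .nil))) (by simp; grind)
    simp only [Walk.edges_cons, Walk.edges_nil, List.mem_cons, List.not_mem_nil, or_false] at hp hq
    rcases hp with rfl | rfl | rfl
    · simp only [Sym2.eq_iff] at hq
      grind
    · simp only [Sym2.eq_iff] at hq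
      grind
    · rfl
  have h2 := Set.ncard_le_ncard h1
  rw [Set.ncard_singleton] at h2
  omega

end SecondNonbridge

section ResidualEdges

variable {V : Type*}

theorem exists_of_mem_attached_edges {G : SimpleGraph V} {u w : V} (hnadj : ¬ G.Adj u w)
    {e : Sym2 V} (he : e ∈ G.edgeSet) (hc : u ∈ e ∨ w ∈ e)
    (hS : ∀ z ∈ e, ¬ (G.Adj u z ∧ G.Adj w z)) (hb : ¬ G.IsBridge e) :
    ∃ c x, (c = u ∨ c = w) ∧ e = s(c, x) ∧ G.Adj c x ∧ x ≠ u ∧ x ≠ w ∧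
      ¬ (G.Adj u x ∧ G.Adj w x) ∧
      ∃ y, y ≠ u ∧ y ≠ w ∧ G.Adj x y ∧ ¬ G.IsBridge s(x, y) := by
  obtain ⟨c, x, hcu, rfl⟩ : ∃ c x, (c = u ∨ c = w) ∧ e = s(c, x) := by
    rcases hc with h | h
    · obtain ⟨x, rfl⟩ := h
      exact ⟨u, x, Or.inl rfl, rfl⟩
    · obtain ⟨x, rfl⟩ := h
      exact ⟨w, x, Or.inr rfl, rfl⟩
  rw [SimpleGraph.mem_edgeSet] at he
  have hxS := hS x (Sym2.mem_mk_right c x)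
  have hxu : x ≠ u := by
    rintro rfl
    rcases hcu with rfl | rfl
    · exact he.ne rfl
    · exact hnadj he.symm
  have hxw : x ≠ w := by
    rintro rfl
    rcases hcu with rfl | rfl
    · exact hnadj he
    · exact he.ne rfl
  obtain ⟨y, hyc, hxy, hyb⟩ := exists_second_nonbridge he hb
  refine ⟨c, x, hcu, rfl, he, hxu, hxw, hxS, y, ?_, ?_, hxy, hyb⟩
  · rintro rfl
    rcases hcu with rfl | rfl
    · exact hyc rfl
    · exact hxS ⟨hxy.symm, he⟩
  · rintro rfl
    rcases hcu with rfl | rfl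
    · exact hxS ⟨he, hxy.symm⟩
    · exact hyc rfl

open Classical in
theorem NoParallelWalks.exists_unique_residual_edge {G : SimpleGraph V} (hG : NoParallelWalks G)
    {u w : V} (huw : u ≠ w) (hnadj : ¬ G.Adj u w) {k : ℕ} {E₁ E₀ : Finset (Sym2 V)}
    (hE₁ : ∀ e, e ∈ E₁ ↔ e ∈ G.edgeSet ∧ (u ∈ e ∨ w ∈ e) ∧ ∀ z ∈ e, ¬ (G.Adj u z ∧ G.Adj w z))
    (hE₀ : ∀ e, e ∈ E₀ ↔ e ∈ G.edgeSet ∧ u ∉ e ∧ w ∉ e)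
    (hexcess : 15 * E₁.card + 26 * E₀.card ≤ 15 * k + 30)
    (hpar : (E₁.card + E₀.card + k) % 2 = 1)
    (hb : (E₁.filter fun e => G.IsBridge e).card + (E₀.filter fun e => G.IsBridge e).card + 2 = k) :
    E₁.card = k ∧ ∃ a a', E₀ = {s(a, a')} ∧ G.Adj a a' ∧ (a ≠ u ∧ a ≠ w ∧ a' ≠ u ∧ a' ≠ w) ∧
      (¬ (G.Adj u a ∧ G.Adj w a) ∧ ¬ (G.Adj u a' ∧ G.Adj w a')) ∧
      (G.Adj u a ∨ G.Adj w a) ∧ (G.Adj u a' ∨ G.Adj w a') := by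
  have h1 := Finset.card_filter_add_card_filter_not (s := E₁) fun e => G.IsBridge e
  have h0 := Finset.card_filter_add_card_filter_not (s := E₀) fun e => G.IsBridge e
  set N₁ := E₁.filter fun e => ¬ G.IsBridge e with hN₁
  set N₀ := E₀.filter fun e => ¬ G.IsBridge e with hN₀
  have hatt : ∀ e ∈ N₁, ∃ c x, (c = u ∨ c = w) ∧ e = s(c, x) ∧ G.Adj c x ∧ x ≠ u ∧ x ≠ w ∧
      ¬ (G.Adj u x ∧ G.Adj w x) ∧ ∃ f ∈ N₀, x ∈ f := by
    intro e he
    rw [hN₁, Finset.mem_filter, hE₁] at he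
    obtain ⟨c, x, hc, rfl, hcx, hxu, hxw, hxS, y, hyu, hyw, hxy, hyb⟩ :=
      exists_of_mem_attached_edges hnadj he.1.1 he.1.2.1 he.1.2.2 he.2
    refine ⟨c, x, hc, rfl, hcx, hxu, hxw, hxS, s(x, y), ?_, Sym2.mem_mk_left x y⟩
    rw [hN₀, Finset.mem_filter, hE₀]
    refine ⟨⟨hxy, ?_, ?_⟩, hyb⟩ <;> rw [Sym2.mem_iff] <;> grind
  have hN₀card : N₀.card = 1 := by
    rcases Nat.eq_zero_or_pos N₀.card with h | h
    · obtain ⟨e, he⟩ : N₁.Nonempty := by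
        rw [← Finset.card_pos]
        omega
      obtain ⟨c, x, -, -, -, -, -, -, f, hf, -⟩ := hatt e he
      rw [Finset.card_eq_zero] at h
      rw [h] at hf
      exact absurd hf (Finset.notMem_empty f)
    · omega
  obtain ⟨f, hf⟩ := Finset.card_eq_one.1 hN₀card
  have hN₁card : N₁.card = 2 := by
    by_contra hne
    have hN₁0 : N₁ = ∅ := by
      rw [← Finset.card_eq_zero]
      omega
    have hfN : f ∈ N₀ := hf ▸ Finset.mem_singleton_self f
    rw [hN₀, Finset.mem_filter, hE₀] at hfN
    obtain ⟨⟨hfE, hfu, hfw⟩, hfb⟩ := hfN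
    obtain ⟨x, v, rfl, hxS⟩ : ∃ x v, f = s(v, x) ∧ ¬ (G.Adj u x ∧ G.Adj w x) := by
      induction f using Sym2.ind with
      | _ y z =>
        by_cases hy : G.Adj u y ∧ G.Adj w y
        · refine ⟨z, y, rfl, fun hz => huw ?_⟩
          exact hG.eq_of_common_neighbors hfE hy.1.symm hz.1 hy.2.symm hz.2
        · exact ⟨y, z, Sym2.eq_swap, hy⟩
    rw [Sym2.mem_iff] at hfu hfw
    obtain ⟨y, hyv, hxy, hyb⟩ := exists_second_nonbridge hfE hfb
    by_cases hyc : y = u ∨ y = w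
    · have : s(x, y) ∈ N₁ := by
        rw [hN₁, Finset.mem_filter, hE₁]
        refine ⟨⟨hxy, by simp only [Sym2.mem_iff]; grind, ?_⟩, hyb⟩
        intro z hz
        rw [Sym2.mem_iff] at hz
        rcases hz with rfl | rfl
        · exact hxS
        · rcases hyc with rfl | rfl
          · exact fun h => h.1.ne rfl
          · exact fun h => h.2.ne rfl
      rw [hN₁0] at this
      exact Finset.notMem_empty _ this
    · have : s(x, y) ∈ N₀ := by
        rw [hN₀, Finset.mem_filter, hE₀]
        refine ⟨⟨hxy, ?_, ?_⟩, hyb⟩ <;> rw [Sym2.mem_iff] <;> grind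
      rw [hf, Finset.mem_singleton, Sym2.eq_iff] at this
      grind
  refine ⟨by omega, ?_⟩
  obtain ⟨e₁, e₂, hne, he⟩ := Finset.card_eq_two.1 hN₁card
  obtain ⟨c₁, a, hc₁, rfl, hca₁, hau, haw, haS, f₁, hf₁, haf⟩ := hatt e₁ (by rw [he]; simp)
  obtain ⟨c₂, a', hc₂, rfl, hca₂, hau', haw', haS', f₂, hf₂, haf'⟩ := hatt e₂ (by rw [he]; simp)
  rw [hf, Finset.mem_singleton] at hf₁ hf₂
  subst hf₁ hf₂
  have haa : a ≠ a' := by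
    rintro rfl
    rcases hc₁ with rfl | rfl <;> rcases hc₂ with rfl | rfl
    · exact hne rfl
    · exact haS ⟨hca₁, hca₂⟩
    · exact haS ⟨hca₂, hca₁⟩
    · exact hne rfl
  have hE : E₀ = {f₂} := by
    rw [← hf]
    refine (Finset.eq_of_subset_of_card_le (Finset.filter_subset _ _) ?_).symm
    rw [← hN₀]
    omega
  have hfa := (Sym2.mem_and_mem_iff haa).1 ⟨haf, haf'⟩
  have hadj : f₂ ∈ G.edgeSet := ((hE₀ f₂).1 (by rw [hE]; simp)).1
  rw [hfa] at hE hadj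
  refine ⟨a, a', hE, hadj, ⟨hau, haw, hau', haw'⟩, ⟨haS, haS'⟩, ?_, ?_⟩
  · rcases hc₁ with rfl | rfl
    · exact Or.inl hca₁
    · exact Or.inr hca₁
  · rcases hc₂ with rfl | rfl
    · exact Or.inl hca₂
    · exact Or.inr hca₂

end ResidualEdges

section EdgeCount

variable {V : Type*}

open Classical in
theorem card_image_union_image {G : SimpleGraph V} {u w : V} (huw : u ≠ w) (hnadj : ¬ G.Adj u w)
    {A B : Finset V} (hA : ∀ z ∈ A, G.Adj u z) :
    (A.image (fun z => s(u, z)) ∪ B.image (fun z => s(w, z))).card = A.card + B.card := by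
  rw [Finset.card_union_of_disjoint, Finset.card_image_of_injective _ fun _ _ => Sym2.congr_right.1,
    Finset.card_image_of_injective _ fun _ _ => Sym2.congr_right.1]
  rw [Finset.disjoint_left]
  intro e he he'
  rw [Finset.mem_image] at he he'
  obtain ⟨z, hz, rfl⟩ := he
  obtain ⟨z', hz', h⟩ := he'
  rw [Sym2.eq_iff] at h
  rcases h with ⟨h, -⟩ | ⟨rfl, -⟩
  · exact huw h.symm
  · exact hnadj (hA _ hz)

open Classical in
theorem edges_at_pair_counts [Fintype V] (G : SimpleGraph V) {u w : V} (huw : u ≠ w)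
    (hnadj : ¬ G.Adj u w) :
    G.edgeSet.ncard = (Finset.univ.filter fun z => G.Adj u z).card
      + (Finset.univ.filter fun z => G.Adj w z).card
      + (G.edgeFinset.filter fun e => u ∉ e ∧ w ∉ e).card ∧
    (Finset.univ.filter fun z => G.Adj u z).card + (Finset.univ.filter fun z => G.Adj w z).card =
      2 * (Finset.univ.filter fun z => G.Adj u z ∧ G.Adj w z).card
      + (G.edgeFinset.filter fun e =>
          (u ∈ e ∨ w ∈ e) ∧ ∀ z ∈ e, ¬ (G.Adj u z ∧ G.Adj w z)).card := by
  have hpair : ∀ (P : V → Prop), (¬ P u) → (¬ P w) →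
      (G.edgeFinset.filter fun e => (u ∈ e ∨ w ∈ e) ∧ ∃ z ∈ e, P z).card =
      (Finset.univ.filter fun z => G.Adj u z ∧ P z).card +
      (Finset.univ.filter fun z => G.Adj w z ∧ P z).card := by
    intro P hPu hPw
    rw [← card_image_union_image huw hnadj (fun z hz => (Finset.mem_filter.1 hz).2.1)]
    congr 1
    ext e
    induction e using Sym2.ind with
    | _ y z =>
      simp only [Finset.mem_filter, SimpleGraph.mem_edgeFinset, SimpleGraph.mem_edgeSet,
        Sym2.mem_iff, Finset.mem_union, Finset.mem_image, Finset.mem_univ, true_and, Sym2.eq_iff]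
      constructor
      · rintro ⟨hyz, hc, v, hv, hPv⟩
        have := hyz.symm
        grind
      · rintro (⟨v, ⟨hv, hP⟩, ⟨rfl, rfl⟩ | ⟨rfl, rfl⟩⟩ | ⟨v, ⟨hv, hP⟩, ⟨rfl, rfl⟩ | ⟨rfl, rfl⟩⟩)
        · exact ⟨hv, by simp, v, by simp, hP⟩
        · exact ⟨hv.symm, by simp, v, by simp, hP⟩
        · exact ⟨hv, by simp, v, by simp, hP⟩
        · exact ⟨hv.symm, by simp, v, by simp, hP⟩
  have hall : (G.edgeFinset.filter fun e => (u ∈ e ∨ w ∈ e) ∧ ∃ z ∈ e, z ≠ u ∧ z ≠ w).card =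
      (Finset.univ.filter fun z => G.Adj u z ∧ (z ≠ u ∧ z ≠ w)).card +
      (Finset.univ.filter fun z => G.Adj w z ∧ (z ≠ u ∧ z ≠ w)).card := by
    convert hpair (fun z => z ≠ u ∧ z ≠ w) (by simp) (by simp)
  have hboth : (G.edgeFinset.filter fun e =>
      (u ∈ e ∨ w ∈ e) ∧ ∃ z ∈ e, G.Adj u z ∧ G.Adj w z).card =
      (Finset.univ.filter fun z => G.Adj u z ∧ (G.Adj u z ∧ G.Adj w z)).card +
      (Finset.univ.filter fun z => G.Adj w z ∧ (G.Adj u z ∧ G.Adj w z)).card := by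
    convert hpair (fun z => G.Adj u z ∧ G.Adj w z) (by simp) (by simp)
  have hEc : (G.edgeFinset.filter fun e => (u ∈ e ∨ w ∈ e) ∧ ∃ z ∈ e, z ≠ u ∧ z ≠ w) =
      G.edgeFinset.filter fun e => u ∈ e ∨ w ∈ e := by
    refine Finset.filter_congr fun e he => ⟨And.left, fun h => ⟨h, ?_⟩⟩
    rw [SimpleGraph.mem_edgeFinset] at he
    induction e using Sym2.ind with
    | _ y z =>
      rw [SimpleGraph.mem_edgeSet] at he
      have h1 := he.ne
      have h2 := he.symm
      simp only [Sym2.mem_iff] at h ⊢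
      clear hpair hall hboth
      by_cases hy : y = u ∨ y = w
      · exact ⟨z, Or.inr rfl, by grind⟩
      · exact ⟨y, Or.inl rfl, by grind⟩
  have hu : (Finset.univ.filter fun z => G.Adj u z ∧ (z ≠ u ∧ z ≠ w)) =
      Finset.univ.filter fun z => G.Adj u z :=
    Finset.filter_congr fun z _ => by grind [G.ne_of_adj]
  have hw : (Finset.univ.filter fun z => G.Adj w z ∧ (z ≠ u ∧ z ≠ w)) =
      Finset.univ.filter fun z => G.Adj w z :=
    Finset.filter_congr fun z _ => by grind [G.ne_of_adj, G.adj_comm]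
  have hu' : (Finset.univ.filter fun z => G.Adj u z ∧ (G.Adj u z ∧ G.Adj w z)) =
      Finset.univ.filter fun z => G.Adj u z ∧ G.Adj w z :=
    Finset.filter_congr fun z _ => by tauto
  have hw' : (Finset.univ.filter fun z => G.Adj w z ∧ (G.Adj u z ∧ G.Adj w z)) =
      Finset.univ.filter fun z => G.Adj u z ∧ G.Adj w z :=
    Finset.filter_congr fun z _ => by tauto
  rw [hEc, hu, hw] at hall
  rw [hu', hw'] at hboth
  have h1 := Finset.card_filter_add_card_filter_not (s := G.edgeFinset) fun e => u ∈ e ∨ w ∈ e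
  have h2 := Finset.card_filter_add_card_filter_not
    (s := G.edgeFinset.filter fun e => u ∈ e ∨ w ∈ e) fun e => ∃ z ∈ e, G.Adj u z ∧ G.Adj w z
  simp only [Finset.filter_filter, not_or, not_exists, not_and] at h1 h2
  have h3 : G.edgeSet.ncard = G.edgeFinset.card := by
    rw [← SimpleGraph.coe_edgeFinset, Set.ncard_coe_finset]
  simp only [not_and]
  constructor <;> omega

end EdgeCount

section Structure

variable {V : Type*} [Fintype V]

open Classical in
theorem sum_eq_add_add_sum_filter {u w : V} (huw : u ≠ w) (f : V → ℝ) :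
    ∑ z, f z = f u + f w + ∑ z with z ≠ u ∧ z ≠ w, f z := by
  have h : (Finset.univ.filter fun z => z ≠ u ∧ z ≠ w) = (Finset.univ.erase u).erase w := by
    ext z
    simp [and_comm]
  rw [h, add_assoc, Finset.add_sum_erase _ f (by simp [huw.symm]),
    Finset.add_sum_erase _ f (Finset.mem_univ u)]

open Classical in
theorem excess_edges_le {G : SimpleGraph V} {u w : V} (huw : u ≠ w) (hnadj : ¬ G.Adj u w)
    {k m : ℕ} (hk : 2 ≤ k) (hm : G.edgeSet.ncard = m) (hmk : (432 * k) ^ 2 ≤ m)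
    {x : V → ℝ} {ρ : ℝ} (hxu : x u = 1) (hx0 : ∀ v, 0 ≤ x v) (hx1 : ∀ v, x v ≤ 1)
    (heig : ∀ v, ∑ z, (if G.Adj v z then x z else 0) = ρ * x v)
    (hρ : (m : ℝ) - k / 2 - 1 ≤ ρ ^ 2)
    (hs : 99 / 100 * (m : ℝ) ≤ 2 * (Finset.univ.filter fun z => G.Adj u z ∧ G.Adj w z).card) :
    15 * (G.edgeFinset.filter fun e =>
        (u ∈ e ∨ w ∈ e) ∧ ∀ z ∈ e, ¬ (G.Adj u z ∧ G.Adj w z)).card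
      + 26 * (G.edgeFinset.filter fun e => u ∉ e ∧ w ∉ e).card ≤ 15 * k + 30 := by
  obtain ⟨h1, h2⟩ := edges_at_pair_counts G huw hnadj
  rw [hm] at h1
  set s := (Finset.univ.filter fun z => G.Adj u z ∧ G.Adj w z).card with hsdef
  set c := (G.edgeFinset.filter fun e =>
    (u ∈ e ∨ w ∈ e) ∧ ∀ z ∈ e, ¬ (G.Adj u z ∧ G.Adj w z)).card
  set e := (G.edgeFinset.filter fun e => u ∉ e ∧ w ∉ e).card
  set R := Finset.univ.filter fun z => z ≠ u ∧ z ≠ w with hR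
  have hsplit : ∀ f : V → ℝ, ∑ z, f z = f u + f w + ∑ z ∈ R, f z :=
    sum_eq_add_add_sum_filter huw
  have hnadj' : ¬ G.Adj w u := fun h => hnadj h.symm
  have hdu : ∑ z ∈ R, (if G.Adj u z then (1 : ℝ) else 0) =
      (Finset.univ.filter fun z => G.Adj u z).card := by
    rw [← Finset.sum_boole, hsplit]
    simp [hnadj]
  have hdw : ∑ z ∈ R, (if G.Adj w z then (1 : ℝ) else 0) =
      (Finset.univ.filter fun z => G.Adj w z).card := by
    rw [← Finset.sum_boole, hsplit]
    simp [hnadj']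
  have hsum : ∑ z ∈ R, (if G.Adj u z then (1 : ℝ) else 0) * (if G.Adj w z then (1 : ℝ) else 0) =
      s := by
    rw [hsdef, ← Finset.sum_boole, hsplit]
    simp [hnadj, hnadj', ← ite_and, and_comm]
  have htot := sum_sum_adj_eq_two_mul_ncard G
  have hrow : ∀ v, ∑ z, (if G.Adj v z then (1 : ℝ) else 0) = (if G.Adj u v then (1 : ℝ) else 0)
      + (if G.Adj w v then (1 : ℝ) else 0) + ∑ z ∈ R, if G.Adj v z then (1 : ℝ) else 0 := by
    intro v
    rw [hsplit]
    simp only [G.adj_comm v]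
  have hm1 : (m : ℝ) = (Finset.univ.filter fun z => G.Adj u z).card
      + (Finset.univ.filter fun z => G.Adj w z).card + e := by exact_mod_cast h1
  have hm2 : ((Finset.univ.filter fun z => G.Adj u z).card : ℝ)
      + (Finset.univ.filter fun z => G.Adj w z).card = 2 * s + c := by exact_mod_cast h2
  have hR0 : ∑ z ∈ R, ∑ y ∈ R, (if G.Adj z y then (1 : ℝ) else 0) = 2 * e := by
    rw [hm, hsplit, hrow u, hrow w, Finset.sum_congr rfl fun v _ => hrow v,
      Finset.sum_add_distrib, Finset.sum_add_distrib, hdu, hdw] at htot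
    simp only [G.irrefl, hnadj, hnadj', if_false] at htot
    linarith
  have key := excess_le_of_dominant_pair (a := fun v z => if G.Adj v z then (1 : ℝ) else 0)
    (x := x) (ρ := ρ) (u := u) (w := w) (R := R) (m := m) (k := k) (s := s) (c := c) (e := e)
    (by simp) (by simp) (by simp [hnadj]) (fun v z => by simp [G.adj_comm])
    (fun v z => by by_cases h : G.Adj v z <;> simp [h]) hsplit (fun v => by simpa using heig v)
    hxu hx0 hx1 (by exact_mod_cast hk) (by exact_mod_cast hmk) hρ hsum (by rw [hdu, hdw, hm2])
    hR0 (by linarith) hs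
  have h5 : (15 * c + 26 * e : ℝ) < (15 * k + 31 : ℕ) := by
    push_cast
    linarith
  have h6 : 15 * c + 26 * e < 15 * k + 31 := by exact_mod_cast h5
  omega

open Classical in
theorem IsMinimallyKLEdgeConnected.exists_structure {G : SimpleGraph V} {k m : ℕ} (hk : 2 ≤ k)
    (hG : IsMinimallyKLEdgeConnected k k G)
    (hm : G.edgeSet.ncard = m) (hmk : (432 * k) ^ 2 ≤ m) (hpar : (m - k) % 2 = 1)
    {x : V → ℝ} {u : V} {ρ : ℝ} (hxu : x u = 1) (hx0 : ∀ v, 0 ≤ x v) (hx1 : ∀ v, x v ≤ 1)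
    (heig : ∀ v, ∑ z, (if G.Adj v z then x z else 0) = ρ * x v)
    (hρ : (m : ℝ) - k / 2 - 1 ≤ ρ ^ 2) :
    ∃ w a a', u ≠ w ∧ ¬ G.Adj u w ∧ G.Adj a a' ∧ (a ≠ u ∧ a ≠ w ∧ a' ≠ u ∧ a' ≠ w) ∧
      (¬ (G.Adj u a ∧ G.Adj w a) ∧ ¬ (G.Adj u a' ∧ G.Adj w a')) ∧
      (∀ z, z ≠ u → z ≠ w → G.Adj u z ∨ G.Adj w z) ∧
      (∀ z z', G.Adj z z' → z ≠ u → z ≠ w → z' ≠ u → z' ≠ w → s(z, z') = s(a, a')) ∧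
      (Finset.univ.filter fun z => G.Adj u z ∧ G.Adj w z).card = (m - k - 1) / 2 ∧
      ((Finset.univ.filter fun z => z ≠ u ∧ z ≠ w ∧ z ≠ a ∧ z ≠ a') \
        (Finset.univ.filter fun z => G.Adj u z ∧ G.Adj w z)).card = k - 2 := by
  have hNP := hG.noParallelWalks hk
  have hb2 := ncard_bridges_add_two_le hk hG
  obtain ⟨w, hwu, hnadj, hs⟩ := hNP.exists_dominant_pair hk hm hmk (by omega) hxu hx0 hx1 heig hρ
  have huw := hwu.symm
  have hexc := excess_edges_le huw hnadj hk hm hmk hxu hx0 hx1 heig hρ hs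
  obtain ⟨h1, h2⟩ := edges_at_pair_counts G huw hnadj
  set S := Finset.univ.filter fun z => G.Adj u z ∧ G.Adj w z with hS
  have hSmem : ∀ z, z ∈ S ↔ G.Adj u z ∧ G.Adj w z := by simp [hS]
  set E₁ := G.edgeFinset.filter fun e =>
    (u ∈ e ∨ w ∈ e) ∧ ∀ z ∈ e, ¬ (G.Adj u z ∧ G.Adj w z) with hE₁
  set E₀ := G.edgeFinset.filter fun e => u ∉ e ∧ w ∉ e with hE₀
  have hE₁mem : ∀ e, e ∈ E₁ ↔ e ∈ G.edgeSet ∧ (u ∈ e ∨ w ∈ e) ∧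
      ∀ z ∈ e, ¬ (G.Adj u z ∧ G.Adj w z) := by simp [hE₁]
  have hE₀mem : ∀ e, e ∈ E₀ ↔ e ∈ G.edgeSet ∧ u ∉ e ∧ w ∉ e := by simp [hE₀]
  have hm2 : 4 * k ≤ m := by nlinarith
  have hS3 : 2 < S.card := by
    have h3 : (4 * 2 : ℝ) ≤ m := by exact_mod_cast (by omega : 4 * 2 ≤ m)
    have h4 : ((2 : ℕ) : ℝ) < S.card := by push_cast; linarith
    exact_mod_cast h4
  obtain ⟨z₁, z₂, z₃, hz₁, hz₂, hz₃, h12, h13, h23⟩ := Finset.two_lt_card_iff.1 hS3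
  rw [hSmem] at hz₁ hz₂ hz₃
  have hb1 := hG.le_ncard_bridges_add_two huw h12 h13 h23 hz₁.1 hz₁.2 hz₂.1 hz₂.2 hz₃.1 hz₃.2
  have hnb : ∀ z ∈ S, ¬ G.IsBridge s(u, z) ∧ ¬ G.IsBridge s(w, z) := by
    intro z hz
    rw [hSmem] at hz
    obtain ⟨z', hz', hne⟩ : ∃ z', (G.Adj u z' ∧ G.Adj w z') ∧ z ≠ z' := by
      by_cases h : z = z₁
      · exact ⟨z₂, hz₂, h ▸ h12⟩
      · exact ⟨z₁, hz₁, h⟩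
    exact ⟨not_isBridge_of_square huw hne hz.1 hz.2 hz'.1 hz'.2,
      not_isBridge_of_square hwu hne hz.2 hz.1 hz'.2 hz'.1⟩
  have hbcard : {e | e ∈ G.edgeSet ∧ G.IsBridge e}.ncard =
      (E₁.filter fun e => G.IsBridge e).card + (E₀.filter fun e => G.IsBridge e).card := by
    rw [← Finset.card_union_of_disjoint, ← Set.ncard_coe_finset]
    · congr 1
      ext e
      simp only [Set.mem_ofPred_eq, Finset.coe_union, Finset.coe_filter, Set.mem_union, hE₁mem,
        hE₀mem]
      constructor
      · rintro ⟨he, hbr⟩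
        by_cases hc : u ∈ e ∨ w ∈ e
        · refine Or.inl ⟨⟨he, hc, fun z hz hzS => ?_⟩, hbr⟩
          have hzu : z ≠ u := fun h => by simp [h] at hzS
          have hzw : z ≠ w := fun h => by simp [h] at hzS
          have := hnb z ((hSmem z).2 hzS)
          rcases hc with hc | hc
          · rw [(Sym2.mem_and_mem_iff hzu.symm).1 ⟨hc, hz⟩] at hbr
            exact this.1 hbr
          · rw [(Sym2.mem_and_mem_iff hzw.symm).1 ⟨hc, hz⟩] at hbr
            exact this.2 hbr
        · exact Or.inr ⟨⟨he, not_or.1 hc⟩, hbr⟩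
      · rintro (⟨h, hbr⟩ | ⟨h, hbr⟩) <;> exact ⟨h.1, hbr⟩
    · rw [Finset.disjoint_left]
      intro e he he'
      rw [Finset.mem_filter, hE₁mem] at he
      rw [Finset.mem_filter, hE₀mem] at he'
      exact not_or.2 he'.1.2 he.1.2.1
  obtain ⟨hE₁card, a, a', hE₀eq, haa, hne, hnS, ha, ha'⟩ :=
    hNP.exists_unique_residual_edge huw hnadj hE₁mem hE₀mem hexc (by omega) (by omega)
  have hE₀card : E₀.card = 1 := by rw [hE₀eq, Finset.card_singleton]
  have honly : ∀ z z', G.Adj z z' → z ≠ u → z ≠ w → z' ≠ u → z' ≠ w → s(z, z') = s(a, a') := by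
    intro z z' h hzu hzw hzu' hzw'
    have : s(z, z') ∈ E₀ := by
      rw [hE₀mem]
      refine ⟨h, ?_, ?_⟩ <;> rw [Sym2.mem_iff] <;> grind
    rwa [hE₀eq, Finset.mem_singleton] at this
  have hcover : ∀ z, z ≠ u → z ≠ w → G.Adj u z ∨ G.Adj w z := by
    intro z hzu hzw
    have : Nontrivial V := ⟨z, u, hzu⟩
    obtain ⟨y, hy⟩ := hG.1.preconnected.exists_adj_of_nontrivial z
    by_cases hyu : y = u
    · exact Or.inl (hyu ▸ hy.symm)
    by_cases hyw : y = w
    · exact Or.inr (hyw ▸ hy.symm)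
    have := honly z y hy hzu hzw hyu hyw
    rw [Sym2.eq_iff] at this
    rcases this with ⟨rfl, -⟩ | ⟨rfl, -⟩
    · exact ha
    · exact ha'
  refine ⟨w, a, a', huw, hnadj, haa, hne, hnS, hcover, honly, ?_, ?_⟩
  · have hScard : S.card = (m - k - 1) / 2 := by omega
    convert hScard
  have hunion := Finset.card_union_add_card_inter (Finset.univ.filter fun z => G.Adj u z)
    (Finset.univ.filter fun z => G.Adj w z)
  rw [← Finset.filter_and, ← hS] at hunion
  have hU : (Finset.univ.filter fun z => G.Adj u z) ∪ (Finset.univ.filter fun z => G.Adj w z) =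
      ((Finset.univ.filter fun z => z ≠ u ∧ z ≠ w ∧ z ≠ a ∧ z ≠ a') \ S) ∪ ({a, a'} ∪ S) := by
    ext z
    have := hcover z
    have h1 : G.Adj u z → z ≠ u ∧ z ≠ w := fun h => ⟨h.ne', fun hzw => hnadj (hzw ▸ h)⟩
    have h2 : G.Adj w z → z ≠ u ∧ z ≠ w := fun h => ⟨fun hzw => hnadj (hzw ▸ h.symm), h.ne'⟩
    simp only [Finset.mem_union, Finset.mem_filter, Finset.mem_univ, true_and, Finset.mem_sdiff,
      hSmem, Finset.mem_insert, Finset.mem_singleton]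
    grind
  rw [hU, Finset.card_union_of_disjoint, Finset.card_union_of_disjoint,
    Finset.card_pair haa.ne] at hunion
  · have hcard : ((Finset.univ.filter fun z => z ≠ u ∧ z ≠ w ∧ z ≠ a ∧ z ≠ a') \ S).card = k - 2 := by
      omega
    convert hcard
  · rw [Finset.disjoint_left]
    intro z hz
    rw [hSmem]
    rw [Finset.mem_insert, Finset.mem_singleton] at hz
    rcases hz with rfl | rfl
    · exact hnS.1
    · exact hnS.2
  · rw [Finset.disjoint_left]
    intro z hz
    rw [Finset.mem_sdiff, Finset.mem_filter] at hz
    simp only [Finset.mem_union, Finset.mem_insert, Finset.mem_singleton, not_or]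
    exact ⟨⟨hz.1.2.2.2.1, hz.1.2.2.2.2⟩, hz.2⟩

end Structure

section Comparison

theorem eq_zero_of_triangle_at_dominant {ρ s p q t y y' : ℝ} (hρ : 2 ≤ ρ)
    (hp : 0 ≤ p) (hq : 0 ≤ q)
    (hY : s ^ 2 ≤ (ρ ^ 2 - s) * (ρ ^ 2 - s - (p + q + 2 * ρ / (ρ - 1))))
    (hy : ρ * y = 1 + y') (hy' : ρ * y' = 1 + y)
    (hu : ρ ^ 2 = s * (1 + t) + p + ρ * (y + y')) (hw : ρ ^ 2 * t = s * (1 + t) + q * t) :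
    q = 0 := by
  have hyy : y + y' = 2 / (ρ - 1) := by
    rw [eq_div_iff (by linarith)]
    linarith
  have hg : ρ * (y + y') = 2 * ρ / (ρ - 1) := by rw [hyy]; ring
  have hg0 : 0 < 2 * ρ / (ρ - 1) := div_pos (by linarith) (by linarith)
  rw [hg] at hu
  set g := 2 * ρ / (ρ - 1)
  have h1 : (ρ ^ 2 - s - (p + g)) * (ρ ^ 2 - s - q) = s ^ 2 := by
    rw [show ρ ^ 2 - s - (p + g) = s * t by linarith]
    linear_combination s * hw
  have h2 : (p + g) * q ≤ 0 := by nlinarith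
  by_contra hne
  have : 0 < q := lt_of_le_of_ne hq (Ne.symm hne)
  nlinarith [mul_pos hg0 this, mul_nonneg hp hq]

theorem false_of_triangle_at_subordinate {ρ s p q t y y' : ℝ} (hρ : 2 ≤ ρ) (hs : 0 < s)
    (hp : 0 ≤ p) (hq : 0 ≤ q) (ht0 : 0 ≤ t) (ht1 : t ≤ 1)
    (hY : s ^ 2 ≤ (ρ ^ 2 - s) * (ρ ^ 2 - s - (p + q + 2 * ρ / (ρ - 1))))
    (hy : ρ * y = t + y') (hy' : ρ * y' = t + y)
    (hu : ρ ^ 2 = s * (1 + t) + p) (hw : ρ ^ 2 * t = s * (1 + t) + q * t + ρ * (y + y')) :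
    False := by
  have hyy : y + y' = 2 * t / (ρ - 1) := by
    rw [eq_div_iff (by linarith)]
    linarith
  have hg : ρ * (y + y') = 2 * ρ / (ρ - 1) * t := by rw [hyy]; ring
  have hg0 : 0 < 2 * ρ / (ρ - 1) := div_pos (by linarith) (by linarith)
  rw [hg] at hw
  set g := 2 * ρ / (ρ - 1)
  have h1 : (ρ ^ 2 - s - p) * (ρ ^ 2 - s - (q + g)) = s ^ 2 := by
    rw [show ρ ^ 2 - s - p = s * t by linarith]
    linear_combination s * hw
  have h2 : p * (q + g) ≤ 0 := by nlinarith
  have hp0 : p = 0 := by nlinarith [mul_nonneg hp hq, mul_nonneg hp hg0.le]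
  subst hp0
  have h3 : (s * t - (q + g)) * t = s := by linear_combination hw - t * hu
  have h4 : 0 < t := lt_of_le_of_ne ht0 fun h => by rw [← h] at h3; simp at h3; linarith
  have h5 : s * t * t ≤ s := by nlinarith [mul_nonneg ht0 (sub_nonneg.2 ht1)]
  nlinarith [mul_pos hg0 h4, mul_nonneg hq ht0]

theorem false_of_path_between {ρ s p q t y y' : ℝ} (hρ : 2 ≤ ρ) (hs : 0 < s)
    (hp : 0 ≤ p) (hq : 0 ≤ q) (hsY : s ≤ ρ ^ 2 - s)
    (hY : s ^ 2 ≤ (ρ ^ 2 - s) * (ρ ^ 2 - s - (p + q + 2 * ρ / (ρ - 1))))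
    (hy : ρ * y = 1 + y') (hy' : ρ * y' = t + y)
    (hu : ρ ^ 2 = s * (1 + t) + p + ρ * y) (hw : ρ ^ 2 * t = s * (1 + t) + q * t + ρ * y') :
    False := by
  have hd : 0 < ρ ^ 2 - 1 := by nlinarith
  obtain ⟨r, hr⟩ : ∃ r, r = ρ / (ρ ^ 2 - 1) := ⟨_, rfl⟩
  obtain ⟨c, hc⟩ : ∃ c, c = ρ ^ 2 / (ρ ^ 2 - 1) := ⟨_, rfl⟩
  have hr0 : 0 < r := hr ▸ div_pos (by linarith) hd
  have hr1 : r < 1 := by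
    rw [hr, div_lt_one hd]
    nlinarith
  have hc1 : 1 ≤ c := by
    rw [hc, one_le_div hd]
    linarith
  have hcr : 2 * ρ / (ρ - 1) = 2 * (c + r) := by
    rw [hc, hr]
    have : ρ - 1 ≠ 0 := by linarith
    field_simp
    ring
  have hyc : ρ * y = c + r * t := by
    rw [hc, hr]
    field_simp
    linear_combination ρ * hy + hy'
  have hyc' : ρ * y' = c * t + r := by
    rw [hc, hr]
    field_simp
    linear_combination ρ * hy' + hy
  rw [hyc] at hu
  rw [hyc'] at hw
  rw [hcr] at hY
  have h1 : (ρ ^ 2 - s - (p + c)) * (ρ ^ 2 - s - (q + c)) = (s + r) ^ 2 := by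
    rw [show ρ ^ 2 - s - (p + c) = (s + r) * t by linarith]
    linear_combination (s + r) * hw
  have h2 : 0 ≤ r * (ρ ^ 2 - s - s) := mul_nonneg hr0.le (by linarith)
  have h3 : 1 ≤ (p + c) * (q + c) := by nlinarith
  nlinarith

end Comparison

section Isomorphism

variable {V : Type*}

open Classical in
theorem sum_adj_eq_of_partition [Fintype V] {G : SimpleGraph V} {v a a' : V} {S T : Finset V}
    {x : V → ℝ} {α β : ℝ} (haa : a ≠ a') (hS : ∀ z ∈ S, G.Adj v z ∧ z ≠ a ∧ z ≠ a' ∧ x z = α)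
    (hT : ∀ z ∈ T, G.Adj v z ∧ z ≠ a ∧ z ≠ a' ∧ x z = β) (hST : Disjoint S T)
    (hcover : ∀ z, G.Adj v z → z = a ∨ z = a' ∨ z ∈ S ∨ z ∈ T) :
    ∑ z, (if G.Adj v z then x z else 0) = S.card * α + T.card * β
      + ((if G.Adj v a then x a else 0) + (if G.Adj v a' then x a' else 0)) := by
  have hN : (Finset.univ.filter fun z => G.Adj v z) =
      S ∪ T ∪ ({a, a'} : Finset V).filter fun z => G.Adj v z := by
    ext z
    have := hcover z
    have := hS z
    have := hT z
    simp only [Finset.mem_filter, Finset.mem_univ, true_and, Finset.mem_union, Finset.mem_insert,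
      Finset.mem_singleton]
    grind
  have hd : Disjoint (S ∪ T) (({a, a'} : Finset V).filter fun z => G.Adj v z) := by
    rw [Finset.disjoint_left]
    intro z hz
    have := hS z
    have := hT z
    simp only [Finset.mem_filter, Finset.mem_insert, Finset.mem_singleton]
    grind
  rw [← Finset.sum_filter, hN, Finset.sum_union hd, Finset.sum_union hST,
    Finset.sum_congr rfl fun z hz => (hS z hz).2.2.2,
    Finset.sum_congr rfl fun z hz => (hT z hz).2.2.2, Finset.sum_const, Finset.sum_const,
    Finset.sum_filter, Finset.sum_pair haa, nsmul_eq_mul, nsmul_eq_mul]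

open Classical in
/-- A graph obtained from a common-neighbourhood set of `u` and `w`, pendant vertices at `u` or `w`
and one extra edge `aa'` has its triangle and all its pendant vertices at `u` as soon as its
spectral radius `ρ` (with eigenvector `x` maximal at `u`) is large enough. -/
theorem triangle_and_pendants_at_dominant [Fintype V] {G : SimpleGraph V} {u w a a' : V}
    {x : V → ℝ} {ρ : ℝ} {S T : Finset V} (huw : u ≠ w) (hnadj : ¬ G.Adj u w) (haa : G.Adj a a')
    (hne : a ≠ u ∧ a ≠ w ∧ a' ≠ u ∧ a' ≠ w)
    (hnS : ¬ (G.Adj u a ∧ G.Adj w a) ∧ ¬ (G.Adj u a' ∧ G.Adj w a'))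
    (hcover : ∀ z, z ≠ u → z ≠ w → G.Adj u z ∨ G.Adj w z)
    (honly : ∀ z z', G.Adj z z' → z ≠ u → z ≠ w → z' ≠ u → z' ≠ w → s(z, z') = s(a, a'))
    (hS : ∀ z, z ∈ S ↔ G.Adj u z ∧ G.Adj w z)
    (hT : ∀ z, z ∈ T ↔ (z ≠ u ∧ z ≠ w ∧ z ≠ a ∧ z ≠ a') ∧ z ∉ S) (hS0 : 0 < S.card)
    (hxu : x u = 1) (hx0 : ∀ v, 0 ≤ x v) (hx1 : ∀ v, x v ≤ 1)
    (heig : ∀ v, ∑ z, (if G.Adj v z then x z else 0) = ρ * x v) (hρ : 2 ≤ ρ)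
    (hsY : (S.card : ℝ) ≤ ρ ^ 2 - S.card)
    (hY : (S.card : ℝ) ^ 2 ≤
      (ρ ^ 2 - S.card) * (ρ ^ 2 - S.card - (T.card + 2 * ρ / (ρ - 1)))) :
    G.Adj u a ∧ G.Adj u a' ∧ ∀ z ∈ T, ¬ G.Adj w z := by
  have hρ0 : ρ ≠ 0 := by linarith
  have hval : ∀ z, z ≠ u → z ≠ w → z ≠ a → z ≠ a' →
      ρ * x z = (if G.Adj u z then 1 else 0) + (if G.Adj w z then x w else 0) := by
    intro z hzu hzw hza hza'
    rw [← heig, sum_eq_add_add_sum_filter huw, Finset.sum_eq_zero, add_zero, hxu]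
    · simp only [G.adj_comm z]
    · intro y hy
      rw [Finset.mem_filter] at hy
      refine if_neg fun h => ?_
      have := honly z y h hzu hzw hy.2.1 hy.2.2
      rw [Sym2.eq_iff] at this
      grind
  have hval' : ∀ b b', (b = a ∧ b' = a' ∨ b = a' ∧ b' = a) →
      ρ * x b = (if G.Adj u b then 1 else 0) + (if G.Adj w b then x w else 0) + x b' := by
    intro b b' hb
    have hbb : G.Adj b b' := by
      rcases hb with ⟨rfl, rfl⟩ | ⟨rfl, rfl⟩
      exacts [haa, haa.symm]
    rw [← heig, sum_eq_add_add_sum_filter huw, Finset.sum_eq_single b', if_pos hbb, hxu]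
    · simp only [G.adj_comm b]
    · intro y hy hyb
      rw [Finset.mem_filter] at hy
      refine if_neg fun h => ?_
      have := honly b y h (by grind) (by grind) hy.2.1 hy.2.2
      rw [Sym2.eq_iff] at this
      grind
    · intro h
      refine absurd ?_ h
      rw [Finset.mem_filter]
      grind
  have ha := hval' a a' (Or.inl ⟨rfl, rfl⟩)
  have ha' := hval' a' a (Or.inr ⟨rfl, rfl⟩)
  have hTu : ∀ z, z ∈ T → (¬ G.Adj w z ↔ G.Adj u z) := by
    intro z hz
    have := (hT z).1 hz
    have := hS z
    have := hcover z
    grind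
  have hu := sum_adj_eq_of_partition (G := G) (v := u) (S := S)
    (T := T.filter fun z => ¬ G.Adj w z) (x := x) (α := (1 + x w) / ρ) (β := 1 / ρ) haa.ne
    (fun z hz => by
      rw [hS] at hz
      have hzu := hz.1.ne'
      have hzw := hz.2.ne'
      have hza : z ≠ a := fun h => hnS.1 (h ▸ hz)
      have hza' : z ≠ a' := fun h => hnS.2 (h ▸ hz)
      refine ⟨hz.1, hza, hza', ?_⟩
      rw [eq_div_iff hρ0, mul_comm, hval z hzu hzw hza hza', if_pos hz.1, if_pos hz.2])
    (fun z hz => by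
      rw [Finset.mem_filter] at hz
      obtain ⟨⟨hzu, hzw, hza, hza'⟩, -⟩ := (hT z).1 hz.1
      have hadj := (hTu z hz.1).1 hz.2
      refine ⟨hadj, hza, hza', ?_⟩
      rw [eq_div_iff hρ0, mul_comm, hval z hzu hzw hza hza', if_pos hadj, if_neg hz.2, add_zero])
    (Finset.disjoint_left.2 fun z hz hz' => ((hT z).1 (Finset.mem_filter.1 hz').1).2 hz)
    (fun z hz => by
      have hzw : z ≠ w := fun h => hnadj (h ▸ hz)
      have := hz.ne'
      have := hT z
      have := hS z
      rw [Finset.mem_filter]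
      grind)
  have hw := sum_adj_eq_of_partition (G := G) (v := w) (S := S)
    (T := T.filter fun z => G.Adj w z) (x := x) (α := (1 + x w) / ρ) (β := x w / ρ) haa.ne
    (fun z hz => by
      rw [hS] at hz
      have hzu := hz.1.ne'
      have hzw := hz.2.ne'
      have hza : z ≠ a := fun h => hnS.1 (h ▸ hz)
      have hza' : z ≠ a' := fun h => hnS.2 (h ▸ hz)
      refine ⟨hz.2, hza, hza', ?_⟩
      rw [eq_div_iff hρ0, mul_comm, hval z hzu hzw hza hza', if_pos hz.1, if_pos hz.2])
    (fun z hz => by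
      rw [Finset.mem_filter] at hz
      obtain ⟨⟨hzu, hzw, hza, hza'⟩, -⟩ := (hT z).1 hz.1
      have hadj : ¬ G.Adj u z := fun h => (hTu z hz.1).2 h hz.2
      refine ⟨hz.2, hza, hza', ?_⟩
      rw [eq_div_iff hρ0, mul_comm, hval z hzu hzw hza hza', if_pos hz.2, if_neg hadj, zero_add])
    (Finset.disjoint_left.2 fun z hz hz' => ((hT z).1 (Finset.mem_filter.1 hz').1).2 hz)
    (fun z hz => by
      have hzu : z ≠ u := fun h => hnadj (h ▸ hz.symm)
      have := hz.ne'
      have := hT z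
      have := hS z
      rw [Finset.mem_filter]
      grind)
  have hcard : (T.card : ℝ) = (T.filter fun z => ¬ G.Adj w z).card
      + (T.filter fun z => G.Adj w z).card := by
    rw [← Finset.card_filter_add_card_filter_not (s := T) fun z => G.Adj w z]
    push_cast
    ring
  rw [heig, hxu] at hu
  rw [heig] at hw
  rw [hcard] at hY
  obtain ⟨p, hp⟩ : ∃ p : ℝ, p = (T.filter fun z => ¬ G.Adj w z).card := ⟨_, rfl⟩
  obtain ⟨q, hq⟩ : ∃ q : ℝ, q = (T.filter fun z => G.Adj w z).card := ⟨_, rfl⟩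
  have hp0 : 0 ≤ p := hp ▸ Nat.cast_nonneg _
  have hq0 : 0 ≤ q := hq ▸ Nat.cast_nonneg _
  rw [← hp, ← hq] at hY
  rw [← hp] at hu
  rw [← hq] at hw
  have hs0 : (0 : ℝ) < S.card := by exact_mod_cast hS0
  obtain ⟨s, hs⟩ : ∃ s : ℝ, s = S.card := ⟨_, rfl⟩
  rw [← hs] at hu hw hsY hY hs0
  have hu' : ρ ^ 2 = s * (1 + x w) + p
      + ρ * ((if G.Adj u a then x a else 0) + (if G.Adj u a' then x a' else 0)) := by
    field_simp at hu
    linear_combination hu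
  have hw' : ρ ^ 2 * x w = s * (1 + x w) + q * x w
      + ρ * ((if G.Adj w a then x a else 0) + (if G.Adj w a' then x a' else 0)) := by
    field_simp at hw
    linear_combination hw
  have hca := hcover a hne.1 hne.2.1
  have hca' := hcover a' hne.2.2.1 hne.2.2.2
  by_cases h1 : G.Adj u a <;> by_cases h2 : G.Adj u a'
  · have h3 : ¬ G.Adj w a := fun h => hnS.1 ⟨h1, h⟩
    have h4 : ¬ G.Adj w a' := fun h => hnS.2 ⟨h2, h⟩
    simp only [h1, h2, h3, h4, if_true, if_false, add_zero, mul_zero] at ha ha' hu' hw'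
    have hq1 := eq_zero_of_triangle_at_dominant hρ hp0 hq0 hY ha ha' hu' hw'
    rw [hq, Nat.cast_eq_zero, Finset.card_eq_zero, Finset.filter_eq_empty_iff] at hq1
    exact ⟨h1, h2, fun z hz => hq1 hz⟩
  · have h3 : ¬ G.Adj w a := fun h => hnS.1 ⟨h1, h⟩
    have h4 : G.Adj w a' := hca'.resolve_left h2
    simp only [h1, h2, h3, h4, if_true, if_false, add_zero, zero_add] at ha ha' hu' hw'
    exact (false_of_path_between hρ hs0 hp0 hq0 hsY hY ha ha' hu' hw').elim
  · have h3 : G.Adj w a := hca.resolve_left h1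
    have h4 : ¬ G.Adj w a' := fun h => hnS.2 ⟨h2, h⟩
    simp only [h1, h2, h3, h4, if_true, if_false, add_zero, zero_add] at ha ha' hu' hw'
    exact (false_of_path_between hρ hs0 hp0 hq0 hsY hY ha' ha hu' hw').elim
  · have h3 : G.Adj w a := hca.resolve_left h1
    have h4 : G.Adj w a' := hca'.resolve_left h2
    simp only [h1, h2, h3, h4, if_true, if_false, add_zero, zero_add, mul_zero] at ha ha' hu' hw'
    exact (false_of_triangle_at_subordinate hρ hs0 hp0 hq0 (hx0 w) (hx1 w) hY ha ha' hu' hw').elim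

theorem nonempty_iso_kbookTri {G : SimpleGraph V} {u w a a' : V} {S T : Finset V} (huw : u ≠ w)
    (hnadj : ¬ G.Adj u w) (haa : G.Adj a a') (hne : a ≠ u ∧ a ≠ w ∧ a' ≠ u ∧ a' ≠ w)
    (hnS : ¬ (G.Adj u a ∧ G.Adj w a) ∧ ¬ (G.Adj u a' ∧ G.Adj w a'))
    (hcover : ∀ z, z ≠ u → z ≠ w → G.Adj u z ∨ G.Adj w z)
    (honly : ∀ z z', G.Adj z z' → z ≠ u → z ≠ w → z' ≠ u → z' ≠ w → s(z, z') = s(a, a'))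
    (hS : ∀ z, z ∈ S ↔ G.Adj u z ∧ G.Adj w z)
    (hT : ∀ z, z ∈ T ↔ (z ≠ u ∧ z ≠ w ∧ z ≠ a ∧ z ≠ a') ∧ z ∉ S)
    (hua : G.Adj u a) (hua' : G.Adj u a') (hTw : ∀ z ∈ T, ¬ G.Adj w z) :
    Nonempty (G ≃g KbookTri T.card S.card) := by
  have henum : ∀ U : Finset V, ∃ σ : Fin U.card → V, Function.Injective σ ∧
      ∀ z, z ∈ U ↔ ∃ i, σ i = z := fun U =>
    ⟨fun i => U.equivFin.symm i, Subtype.val_injective.comp U.equivFin.symm.injective,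
      fun z => ⟨fun hz => ⟨U.equivFin ⟨z, hz⟩, by simp⟩, fun ⟨i, hi⟩ => hi ▸ (U.equivFin.symm i).2⟩⟩
  obtain ⟨σ, hσ, hσS⟩ := henum S
  obtain ⟨τ, hτ, hτT⟩ := henum T
  have hSu : ∀ i, G.Adj u (σ i) ∧ G.Adj w (σ i) := fun i => (hS _).1 ((hσS _).2 ⟨i, rfl⟩)
  have hSne : ∀ i, σ i ≠ u ∧ σ i ≠ w ∧ σ i ≠ a ∧ σ i ≠ a' := fun i =>
    ⟨(hSu i).1.ne', (hSu i).2.ne', fun h => hnS.1 (h ▸ hSu i), fun h => hnS.2 (h ▸ hSu i)⟩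
  have hTne : ∀ i, τ i ≠ u ∧ τ i ≠ w ∧ τ i ≠ a ∧ τ i ≠ a' := fun i =>
    ((hT _).1 ((hτT _).2 ⟨i, rfl⟩)).1
  have hTw' : ∀ i, ¬ G.Adj w (τ i) := fun i => hTw _ ((hτT _).2 ⟨i, rfl⟩)
  have hTu : ∀ i, G.Adj u (τ i) := fun i =>
    (hcover _ (hTne i).1 (hTne i).2.1).resolve_right (hTw' i)
  have hST : ∀ i j, σ i ≠ τ j := fun i j h => hTw' j (h ▸ (hSu i).2)
  have hwa : ¬ G.Adj w a := fun h => hnS.1 ⟨hua, h⟩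
  have hwa' : ¬ G.Adj w a' := fun h => hnS.2 ⟨hua', h⟩
  have hno : ∀ z z', (z ≠ u ∧ z ≠ w ∧ z ≠ a ∧ z ≠ a') → z' ≠ u ∧ z' ≠ w →
      ¬ G.Adj z z' := by
    intro z z' hz hz' h
    have := honly z z' h hz.1 hz.2.1 hz'.1 hz'.2
    rw [Sym2.eq_iff] at this
    grind
  let f : KbookTriV T.card S.card → V := Sum.elim (Sum.elim (fun _ => u) fun _ => w)
    (Sum.elim (Sum.elim σ τ) ![a, a'])
  have hinj : Function.Injective f := by
    have := haa.ne
    rintro ((_ | _) | ((i | i) | i)) ((_ | _) | ((j | j) | j)) h <;>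
      (try fin_cases i) <;> (try fin_cases j)
    all_goals
      simp only [f, Sum.elim_inl, Sum.elim_inr, Matrix.cons_val_zero, Matrix.cons_val_one,
        Fin.zero_eta, Fin.mk_one] at h
      grind [Function.Injective]
  have hsurj : Function.Surjective f := by
    intro z
    by_cases hzu : z = u
    · exact ⟨Sum.inl (Sum.inl ()), hzu.symm⟩
    by_cases hzw : z = w
    · exact ⟨Sum.inl (Sum.inr ()), hzw.symm⟩
    by_cases hza : z = a
    · exact ⟨Sum.inr (Sum.inr 0), hza.symm⟩
    by_cases hza' : z = a'
    · exact ⟨Sum.inr (Sum.inr 1), hza'.symm⟩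
    by_cases hzS : z ∈ S
    · obtain ⟨i, hi⟩ := (hσS z).1 hzS
      exact ⟨Sum.inr (Sum.inl (Sum.inl i)), hi⟩
    · obtain ⟨i, hi⟩ := (hτT z).1 ((hT z).2 ⟨⟨hzu, hzw, hza, hza'⟩, hzS⟩)
      exact ⟨Sum.inr (Sum.inl (Sum.inr i)), hi⟩
  have hadj : ∀ x y, G.Adj (f x) (f y) ↔ (KbookTri T.card S.card).Adj x y := by
    rintro ((_ | _) | ((i | i) | i)) ((_ | _) | ((j | j) | j)) <;>
      (try fin_cases i) <;> (try fin_cases j)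
    all_goals
      simp only [KbookTri, fromRel_adj, f, Sum.elim_inl, Sum.elim_inr, Matrix.cons_val_zero,
        Matrix.cons_val_one, Fin.zero_eta, Fin.mk_one]
      simp
    all_goals grind [SimpleGraph.adj_comm]
  exact ⟨(RelIso.mk (Equiv.ofBijective f ⟨hinj, hsurj⟩) fun {x y} => hadj x y).symm⟩

end Isomorphism

theorem IsMinimallyKLEdgeConnected.nonempty_iso_kbookTri {V : Type*} [Fintype V] [DecidableEq V]
    {G : SimpleGraph V} {k m : ℕ} (hk : 2 ≤ k) (hG : IsMinimallyKLEdgeConnected k k G)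
    (hsize : G.edgeSet.ncard = m) (hm : (432 * k) ^ 2 ≤ m) (hpar : (m - k) % 2 = 1)
    (hle : specRad (KbookTri (k - 2) ((m - k - 1) / 2)) ≤ specRad G) :
    Nonempty (G ≃g KbookTri (k - 2) ((m - k - 1) / 2)) := by
  classical
  have := hG.1.nonempty
  have hkm : 4 * k ≤ m := by nlinarith
  obtain ⟨s, hs⟩ : ∃ s, s = (m - k - 1) / 2 := ⟨_, rfl⟩
  obtain ⟨p, hp⟩ : ∃ p, p = k - 2 := ⟨_, rfl⟩
  have hs1 : 1 ≤ s := by omega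
  rw [← hs, ← hp] at hle ⊢
  have hρ2 := (two_le_specRad_kbookTri p s).trans hle
  have hsq : specRad (KbookTri p s) ^ 2 ≤ specRad G ^ 2 := by
    have := two_le_specRad_kbookTri p s
    gcongr
  have hprop := (kbookTri_specRad_properties p s hs1).2.1.trans hsq
  have hmR : (m : ℝ) = 2 * s + k + 1 := by exact_mod_cast (by omega : m = 2 * s + k + 1)
  have hkR : (k : ℝ) = p + 2 := by exact_mod_cast (by omega : k = p + 2)
  obtain ⟨x, u, hxu, hx0, hx1, heig⟩ := exists_normalized_eigenvector G
  obtain ⟨w, a, a', huw, hnadj, haa, hne, hnS, hcover, honly, hScard, hTcard⟩ :=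
    hG.exists_structure hk hsize hm hpar hxu hx0 hx1 heig (by linarith)
  obtain ⟨S, hS⟩ : ∃ S : Finset V, S = Finset.univ.filter fun z => G.Adj u z ∧ G.Adj w z :=
    ⟨_, rfl⟩
  obtain ⟨T, hT⟩ : ∃ T : Finset V,
      T = (Finset.univ.filter fun z => z ≠ u ∧ z ≠ w ∧ z ≠ a ∧ z ≠ a') \ S := ⟨_, rfl⟩
  replace hScard : S.card = s := by
    rw [hs, ← hScard, hS]
  replace hTcard : T.card = p := by
    rw [hp, hT, hS]
    convert hTcard
  have hSmem : ∀ z, z ∈ S ↔ G.Adj u z ∧ G.Adj w z := by simp [hS]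
  have hTmem : ∀ z, z ∈ T ↔ (z ≠ u ∧ z ≠ w ∧ z ≠ a ∧ z ≠ a') ∧ z ∉ S := by simp [hT]
  have hY := sq_le_of_specRad_kbookTri_le p s hs1 hle
  have hp0 : (0 : ℝ) ≤ p := Nat.cast_nonneg p
  subst hScard hTcard
  obtain ⟨hua, hua', hTw⟩ := triangle_and_pendants_at_dominant huw hnadj haa hne hnS hcover honly
    hSmem hTmem hs1 hxu hx0 hx1 (fun v => by convert heig v) hρ2 (by linarith) hY
  exact _root_.nonempty_iso_kbookTri huw hnadj haa hne hnS hcover honly hSmem hTmem hua hua' hTw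


/-- Let `k ≥ 2` and let `G` be a minimally `(k,k)`-edge-connected graph of size
`m ≥ (432k)²`, where `m − k ≡ 1 (mod 2)`.  Then
`ρ(G) ≤ ρ(K^{k−2}_{2,(m−k−1)/2} * K₃)`, with equality if and only if
`G ≅ K^{k−2}_{2,(m−k−1)/2} * K₃`. -/
theorem spectral_radius_of_minimally_kk_edge_connected_size_odd
    {V : Type*} [Fintype V] [DecidableEq V] (G : SimpleGraph V) (k m : ℕ)
    (hk : 2 ≤ k) (hsize : G.edgeSet.ncard = m) (hm : (432 * k) ^ 2 ≤ m)
    (hpar : (m - k) % 2 = 1)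
    (hG : IsMinimallyKLEdgeConnected k k G) :
    specRad G ≤ specRad (KbookTri (k - 2) ((m - k - 1) / 2)) ∧
    (specRad G = specRad (KbookTri (k - 2) ((m - k - 1) / 2)) ↔
      Nonempty (G ≃g KbookTri (k - 2) ((m - k - 1) / 2))) := by
  have key := hG.nonempty_iso_kbookTri hk hsize hm hpar
  have heq : specRad (KbookTri (k - 2) ((m - k - 1) / 2)) ≤ specRad G →
      specRad G = specRad (KbookTri (k - 2) ((m - k - 1) / 2)) :=
    fun h => (key h).elim specRad_congr
  refine ⟨?_, fun h => key h.ge, fun ⟨e⟩ => specRad_congr e⟩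
  by_contra! h
  exact h.ne' (heq h.le)
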